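/- Let δ be a fixed real number and ν ≥ 0. (i) If 0 < a ≤ 2 then the positive zeros of the cylinder functions C_ν and C_{ν+a} are interlaced on (0,∞). (ii) If 0 < b ≤ 1 then the positive zeros of J_ν′ and J_{ν+b}′ are interlaced on (0,∞), and the positive zeros of Y_ν′ and Y_{ν+b}′ are interlaced on (0,∞), where primes denote derivatives with respect to x. -/

import Mathlib

open Real Filter Topology Set

/-- Bessel function of the first kind of real order `ν`:
`J_ν(x) = ∑ ((−1)^m / (m! Γ(m+ν+1))) (x/2)^{2m+ν}` (with `1/Γ = 0` at nonpositive
integers, which agrees with Lean's `1/0 = 0` since `Real.Gamma` vanishes there). -/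
noncomputable def besselJ (ν : ℝ) (x : ℝ) : ℝ :=
  ∑' m : ℕ, ((-1 : ℝ) ^ m / (m.factorial * Real.Gamma ((m : ℝ) + ν + 1))) *
    (x / 2) ^ (2 * (m : ℝ) + ν)

/-- Bessel function of the second kind, characterized as the limit
`(J_μ(x) cos(μπ) − J_{−μ}(x)) / sin(μπ) → Y_ν(x)` as `μ → ν` through non-integer reals. -/
noncomputable def besselY (ν : ℝ) (x : ℝ) : ℝ :=
  limUnder (𝓝[{μ : ℝ | ∀ n : ℤ, μ ≠ (n : ℝ)}] ν)
    (fun μ : ℝ => (besselJ μ x * Real.cos (μ * π) - besselJ (-μ) x) / Real.sin (μ * π))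

/-- The cylinder function `C_ν(x) = cos δ · J_ν(x) − sin δ · Y_ν(x)`. -/
noncomputable def cylinder (δ ν : ℝ) (x : ℝ) : ℝ :=
  Real.cos δ * besselJ ν x - Real.sin δ * besselY ν x

/-- One direction of the interlacing property: between any two consecutive zeros of `f`
in `I` there is exactly one zero of `g`. -/
def InterlaceHalf (f g : ℝ → ℝ) (I : Set ℝ) : Prop :=
  ∀ x₁ ∈ I, ∀ x₂ ∈ I, x₁ < x₂ → f x₁ = 0 → f x₂ = 0 →
    (∀ x ∈ Set.Ioo x₁ x₂, f x ≠ 0) →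
    ∃! x, x ∈ Set.Ioo x₁ x₂ ∧ g x = 0

/-- `f` and `g` have interlaced zeros on `I`. -/
def InterlacedOn (f g : ℝ → ℝ) (I : Set ℝ) : Prop :=
  InterlaceHalf f g I ∧ InterlaceHalf g f I

/-- exponential generating function of a sequence -/
noncomputable def egf (c : ℕ → ℝ) (y : ℝ) : ℝ := ∑' m : ℕ, c m * (y ^ m / m.factorial)

lemma egf_summable {c : ℕ → ℝ} {C : ℝ} (hc : ∀ m, |c m| ≤ C) (y : ℝ) :
    Summable fun m : ℕ => c m * (y ^ m / m.factorial) := by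
  refine Summable.of_norm_bounded (g := fun m : ℕ => C * (|y| ^ m / m.factorial))
    ((Real.summable_pow_div_factorial |y|).mul_left C) ?_
  intro m
  rw [norm_mul, norm_div, norm_pow, Real.norm_eq_abs, Real.norm_eq_abs, Real.norm_eq_abs,
    abs_of_nonneg (Nat.cast_nonneg (α := ℝ) m.factorial)]
  exact mul_le_mul_of_nonneg_right (hc m) (by positivity)

lemma hasDerivAt_egf {c : ℕ → ℝ} {C : ℝ} (hc : ∀ m, |c m| ≤ C) (y : ℝ) :
    HasDerivAt (egf c) (egf (fun m => c (m + 1)) y) y := by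
  set R : ℝ := |y| + 1 with hR
  have hC : 0 ≤ C := (abs_nonneg _).trans (hc 0)
  have key : HasDerivAt (fun z => ∑' m : ℕ, c m * (z ^ m / m.factorial))
      (∑' m : ℕ, c m * ((m : ℝ) * y ^ (m - 1) / m.factorial)) y := by
    refine hasDerivAt_tsum_of_isPreconnected (t := Metric.ball (0 : ℝ) R)
      (u := fun m : ℕ => C * ((m : ℝ) * R ^ (m - 1) / m.factorial))
      (g := fun m z => c m * (z ^ m / m.factorial))
      (g' := fun m z => c m * ((m : ℝ) * z ^ (m - 1) / m.factorial)) (y₀ := 0) ?_ Metric.isOpen_ball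
      (convex_ball _ _).isPreconnected ?_ ?_ ?_ ?_ ?_
    · refine Summable.mul_left C ?_
      rw [← summable_nat_add_iff 1]
      refine (Real.summable_pow_div_factorial R).congr ?_
      intro m
      rw [Nat.factorial_succ]
      have : (m.factorial : ℝ) ≠ 0 := by positivity
      push_cast
      field_simp
    · intro m z _
      exact ((hasDerivAt_pow m z).div_const _).const_mul _
    · intro m z hz
      have hz' : |z| ≤ R := by
        have := Metric.mem_ball.1 hz
        rw [dist_zero_right, Real.norm_eq_abs] at this
        exact this.le
      rw [norm_mul, norm_div, norm_mul, norm_pow, Real.norm_eq_abs, Real.norm_eq_abs,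
        Real.norm_eq_abs, Real.norm_eq_abs,
        abs_of_nonneg (Nat.cast_nonneg (α := ℝ) m.factorial), abs_of_nonneg (Nat.cast_nonneg (α := ℝ) m)]
      refine mul_le_mul (hc m) ?_ (by positivity) hC
      gcongr
    · simp only [Metric.mem_ball, dist_self]; positivity
    · exact egf_summable hc 0
    · rw [Metric.mem_ball, dist_zero_right, Real.norm_eq_abs]; linarith
  have h2 : (∑' m : ℕ, c m * ((m : ℝ) * y ^ (m - 1) / m.factorial))
      = egf (fun m => c (m + 1)) y := by
    have hterm : ∀ m : ℕ, c (m + 1) * (((m + 1 : ℕ) : ℝ) * y ^ (m + 1 - 1) / (m + 1).factorial)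
        = c (m + 1) * (y ^ m / m.factorial) := by
      intro m
      rw [Nat.factorial_succ]
      have : (m.factorial : ℝ) ≠ 0 := by positivity
      push_cast
      field_simp
    have hs : Summable fun m : ℕ => c m * ((m : ℝ) * y ^ (m - 1) / m.factorial) := by
      rw [← summable_nat_add_iff 1]
      exact (egf_summable (c := fun m => c (m + 1)) (fun m => hc (m + 1)) y).congr
        (fun m => (hterm m).symm)
    rw [hs.tsum_eq_zero_add]
    simp only [hterm, egf]
    simp
  rw [h2] at key
  exact key

lemma inv_Gamma_rec (s : ℝ) : s * (Real.Gamma (s + 1))⁻¹ = (Real.Gamma s)⁻¹ := by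
  by_cases h : s = 0
  · subst h; simp [Real.Gamma_zero]
  · rw [Real.Gamma_add_one h, mul_inv]; field_simp

/-- coefficients of the Bessel series -/
noncomputable def bco (ν : ℝ) (m : ℕ) : ℝ := (-1) ^ m * (Real.Gamma ((m : ℝ) + ν + 1))⁻¹

lemma bco_rec (ν : ℝ) (m : ℕ) : bco (ν - 1) m = ((m : ℝ) + ν) * bco ν m := by
  unfold bco
  have := inv_Gamma_rec ((m : ℝ) + ν)
  rw [show (m : ℝ) + (ν - 1) + 1 = m + ν by ring, ← this]; ring

lemma bco_shift (ν : ℝ) (m : ℕ) : bco ν (m + 1) = - bco (ν + 1) m := by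
  unfold bco
  push_cast
  rw [show (m : ℝ) + 1 + ν + 1 = m + (ν + 1) + 1 by ring, pow_succ]; ring

lemma bco_bounded (ν : ℝ) : ∃ C, ∀ m, |bco ν m| ≤ C := by
  obtain ⟨N, hN⟩ := exists_nat_ge (|ν|)
  have hstep : ∀ m, N ≤ m → |bco ν (m + 1)| ≤ |bco ν m| := by
    intro m hm
    have h1 := bco_rec (ν + 1) m
    rw [add_sub_cancel_right] at h1
    rw [bco_shift, abs_neg, h1, abs_mul]
    have : (1 : ℝ) ≤ |(m : ℝ) + (ν + 1)| := by
      have h2 : (N : ℝ) ≤ m := by exact_mod_cast hm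
      have h3 := neg_abs_le ν
      exact le_trans (by linarith) (le_abs_self _)
    exact le_mul_of_one_le_left (abs_nonneg _) this
  refine ⟨∑ m ∈ Finset.range (N + 1), |bco ν m|, ?_⟩
  have h0 : ∀ k, |bco ν (N + k)| ≤ |bco ν N| := by
    intro k
    induction k with
    | zero => simp
    | succ k ih => exact (hstep (N + k) (by omega)).trans ih
  have hle : ∀ m ≤ N, |bco ν m| ≤ ∑ m ∈ Finset.range (N + 1), |bco ν m| := by
    intro m hm
    exact Finset.single_le_sum (f := fun m => |bco ν m|) (fun _ _ => abs_nonneg _)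
      (Finset.mem_range.2 (by omega))
  intro m
  by_cases h : m ≤ N
  · exact hle m h
  · obtain ⟨k, rfl⟩ := Nat.exists_eq_add_of_le (not_le.1 h).le
    exact (h0 k).trans (hle N le_rfl)

noncomputable def bE (ν y : ℝ) : ℝ := egf (bco ν) y

lemma hasDerivAt_bE (ν y : ℝ) : HasDerivAt (bE ν) (- bE (ν + 1) y) y := by
  obtain ⟨C, hC⟩ := bco_bounded ν
  have := hasDerivAt_egf hC y
  have e : egf (fun m => bco ν (m+1)) y = - bE (ν+1) y := by
    unfold bE egf
    rw [← tsum_neg]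
    congr 1; funext m; simp only [bco_shift]; ring
  rw [e] at this
  exact this

lemma bE_rec (ν y : ℝ) : bE (ν - 1) y = ν * bE ν y - y * bE (ν + 1) y := by
  obtain ⟨C, hC⟩ := bco_bounded ν
  obtain ⟨C', hC'⟩ := bco_bounded (ν + 1)
  have h1 := egf_summable hC y
  have hs : Summable fun m : ℕ => bco ν m * ((m : ℝ) * (y ^ m / m.factorial)) := by
    rw [← summable_nat_add_iff 1]
    refine (((egf_summable hC' y).mul_left (-y))).congr ?_
    intro m
    rw [bco_shift, Nat.factorial_succ]
    have : (m.factorial : ℝ) ≠ 0 := by positivity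
    push_cast
    field_simp
    ring
  have hy : ∑' m : ℕ, bco ν m * ((m : ℝ) * (y ^ m / m.factorial)) = -(y * bE (ν + 1) y) := by
    rw [hs.tsum_eq_zero_add]
    unfold bE egf
    rw [← tsum_mul_left, ← tsum_neg]
    simp only [Nat.cast_zero, zero_mul, mul_zero, zero_add]
    congr 1; funext m
    rw [bco_shift, Nat.factorial_succ]
    have : (m.factorial : ℝ) ≠ 0 := by positivity
    push_cast
    field_simp
    ring
  have : bE (ν - 1) y = ν * bE ν y + ∑' m : ℕ, bco ν m * ((m : ℝ) * (y ^ m / m.factorial)) := by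
    unfold bE egf
    rw [← tsum_mul_left, ← (h1.mul_left ν).tsum_add hs]
    congr 1; funext m
    rw [bco_rec]; ring
  rw [this, hy]; ring

lemma bE_zero (ν : ℝ) : bE ν 0 = (Real.Gamma (ν + 1))⁻¹ := by
  unfold bE egf
  rw [tsum_eq_single 0]
  · simp [bco]
  · intro m hm; simp [hm]

lemma besselJ_eq {ν x : ℝ} (hx : 0 < x) : besselJ ν x = (x / 2) ^ ν * bE ν ((x / 2) ^ 2) := by
  unfold besselJ bE egf
  rw [← tsum_mul_left]
  congr 1; funext m
  have hx2 : 0 < x / 2 := by positivity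
  rw [Real.rpow_add hx2, ← pow_mul]
  have : (x / 2) ^ (2 * (m : ℝ)) = (x / 2) ^ (2 * m) := by
    rw [← Real.rpow_natCast]; push_cast; rfl
  rw [this]
  unfold bco
  rw [div_eq_mul_inv, mul_inv]; ring

lemma besselJ_rec {ν x : ℝ} (hx : 0 < x) :
    besselJ (ν - 1) x + besselJ (ν + 1) x = 2 * ν / x * besselJ ν x := by
  have hx2 : 0 < x / 2 := by positivity
  rw [besselJ_eq hx, besselJ_eq hx, besselJ_eq hx, bE_rec, Real.rpow_sub_one hx2.ne',
    Real.rpow_add_one hx2.ne']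
  field_simp
  ring

lemma hasDerivAt_besselJ {ν x : ℝ} (hx : 0 < x) :
    HasDerivAt (besselJ ν) (ν / x * besselJ ν x - besselJ (ν + 1) x) x := by
  have hx2 : 0 < x / 2 := by positivity
  have h1 : HasDerivAt (fun z : ℝ => (z / 2) ^ ν) ((1 / 2) * ν * (x / 2) ^ (ν - 1)) x :=
    ((hasDerivAt_id x).div_const 2).rpow_const (Or.inl hx2.ne')
  have h2 : HasDerivAt (fun z : ℝ => bE ν ((z / 2) ^ 2)) (- bE (ν + 1) ((x / 2) ^ 2) * (x / 2)) x := by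
    have h3 : HasDerivAt (fun z : ℝ => (z / 2) ^ 2) (x / 2) x := by
      refine (((hasDerivAt_id' x).div_const 2).pow 2).congr_deriv ?_
      norm_num
      ring
    exact (hasDerivAt_bE ν ((x / 2) ^ 2)).comp x h3
  have h4 := h1.mul h2
  have h5 : HasDerivAt (besselJ ν) _ x := h4.congr_of_eventuallyEq (by
    filter_upwards [lt_mem_nhds hx] with z hz
    exact besselJ_eq hz)
  convert h5 using 1
  rw [besselJ_eq hx, besselJ_eq hx, Real.rpow_sub_one hx2.ne', Real.rpow_add_one hx2.ne']
  field_simp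
  ring

lemma continuous_bE (ν : ℝ) : Continuous (bE ν) :=
  continuous_iff_continuousAt.2 fun y => (hasDerivAt_bE ν y).continuousAt

/-- leading behaviour at zero -/
lemma besselJ_tendsto_scaled (ν : ℝ) :
    Tendsto (fun x => (x / 2) ^ (-ν) * besselJ ν x) (𝓝[>] 0) (𝓝 ((Real.Gamma (ν + 1))⁻¹)) := by
  have h : Tendsto (fun x : ℝ => bE ν ((x / 2) ^ 2)) (𝓝[>] 0) (𝓝 (bE ν 0)) := by
    have : Continuous fun x : ℝ => bE ν ((x / 2) ^ 2) := (continuous_bE ν).comp (by fun_prop)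
    have h2 := this.tendsto 0
    simp only [zero_div, ne_eq, OfNat.ofNat_ne_zero, not_false_eq_true, zero_pow] at h2
    exact h2.mono_left nhdsWithin_le_nhds
  rw [bE_zero] at h
  refine h.congr' ?_
  filter_upwards [self_mem_nhdsWithin] with x hx
  have hx2 : 0 < x / 2 := half_pos hx
  rw [besselJ_eq hx, ← mul_assoc, ← Real.rpow_add hx2]; simp

lemma besselJ_tendsto_zero {ν : ℝ} (hν : 0 < ν) : Tendsto (besselJ ν) (𝓝[>] 0) (𝓝 0) := by
  have h1 : Tendsto (fun x : ℝ => (x / 2) ^ ν) (𝓝[>] 0) (𝓝 0) := by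
    have : Continuous fun x : ℝ => (x / 2) ^ ν :=
      (continuous_id.div_const 2).rpow_const (fun _ => Or.inr hν.le)
    have h2 := this.tendsto 0
    rw [zero_div, Real.zero_rpow hν.ne'] at h2
    exact h2.mono_left nhdsWithin_le_nhds
  have h := h1.mul (besselJ_tendsto_scaled ν)
  rw [zero_mul] at h
  refine h.congr' ?_
  filter_upwards [self_mem_nhdsWithin] with x hx
  have hx2 : 0 < x / 2 := half_pos hx
  rw [← mul_assoc, ← Real.rpow_add hx2]; simp

/-- finite part of Schlaefli's integral -/
noncomputable def sA (ν x : ℝ) : ℂ :=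
  ∫ φ in (0:ℝ)..π, Complex.exp (Complex.I * ((x * Real.sin φ - ν * φ : ℝ) : ℂ))

/-- infinite part of Schlaefli's integral -/
noncomputable def sB (ν x : ℝ) : ℝ := ∫ t in Ioi (0:ℝ), Real.exp (ν * t - x * Real.sinh t)

/-- The Hankel function -/
noncomputable def hk (ν x : ℝ) : ℂ :=
  (1 / π : ℂ) * (sA ν x - Complex.I * ((sB ν x : ℂ)
    + Complex.exp (-(Complex.I * ((ν * π : ℝ) : ℂ))) * (sB (-ν) x : ℂ)))

lemma sq_le_sinh {t : ℝ} (ht : 0 ≤ t) : t ^ 2 / 4 ≤ Real.sinh t := by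
  have h1 := Real.quadratic_le_exp_of_nonneg ht
  have h2 : Real.exp (-t) ≤ 1 := Real.exp_le_one_iff.2 (by linarith)
  rw [Real.sinh_eq]
  nlinarith

lemma sB_exponent_le (ν : ℝ) {x : ℝ} (hx : 0 < x) :
    ∀ᶠ t : ℝ in atTop, ν * t - x * Real.sinh t ≤ -t := by
  filter_upwards [eventually_ge_atTop (4 * (|ν| + 1) / x), eventually_ge_atTop 0] with t ht ht0
  have h1 := sq_le_sinh ht0
  have h2 : x * (t ^ 2 / 4) ≤ x * Real.sinh t := by gcongr
  have h3 : 4 * (|ν| + 1) ≤ t * x := by rwa [div_le_iff₀ hx] at ht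
  have h4 := le_abs_self ν
  nlinarith

lemma sB_integrable (ν : ℝ) {x : ℝ} (hx : 0 < x) :
    MeasureTheory.IntegrableOn (fun t => Real.exp (ν * t - x * Real.sinh t)) (Ioi 0) := by
  refine integrable_of_isBigO_exp_neg (b := 1) one_pos ?_ ?_
  · exact Continuous.continuousOn (by fun_prop)
  · refine Asymptotics.IsBigO.of_bound 1 ?_
    filter_upwards [sB_exponent_le ν hx] with t ht
    rw [Real.norm_eq_abs, Real.norm_eq_abs, abs_of_pos (Real.exp_pos _),
      abs_of_pos (Real.exp_pos _), one_mul]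
    exact Real.exp_le_exp.2 (by linarith)

lemma sB_tendsto (ν : ℝ) {x : ℝ} (hx : 0 < x) :
    Tendsto (fun t => Real.exp (ν * t - x * Real.sinh t)) atTop (𝓝 0) := by
  refine squeeze_zero' (Eventually.of_forall fun t => (Real.exp_pos _).le)
    ?_ (Real.tendsto_exp_neg_atTop_nhds_zero)
  filter_upwards [sB_exponent_le ν hx] with t ht
  exact Real.exp_le_exp.2 ht

lemma exp_shift_add (ν x t : ℝ) : Real.exp ((ν + 1) * t - x * Real.sinh t)
    = Real.exp t * Real.exp (ν * t - x * Real.sinh t) := by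
  rw [← Real.exp_add]; congr 1; ring

lemma exp_shift_sub (ν x t : ℝ) : Real.exp ((ν - 1) * t - x * Real.sinh t)
    = Real.exp (-t) * Real.exp (ν * t - x * Real.sinh t) := by
  rw [← Real.exp_add]; congr 1; ring

lemma hasDerivAt_sB (ν : ℝ) {x : ℝ} (hx : 0 < x) :
    HasDerivAt (sB ν) ((sB (ν - 1) x - sB (ν + 1) x) / 2) x := by
  have key := (hasDerivAt_integral_of_dominated_loc_of_deriv_le
    (μ := MeasureTheory.volume.restrict (Ioi (0:ℝ)))
    (F := fun y t => Real.exp (ν * t - y * Real.sinh t))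
    (F' := fun y t => Real.exp (ν * t - y * Real.sinh t) * (- Real.sinh t))
    (bound := fun t => Real.exp ((ν + 1) * t - (x / 2) * Real.sinh t))
    (x₀ := x) (s := Ioi (x / 2)) (Ioi_mem_nhds (by linarith))
    (Eventually.of_forall fun y => Continuous.aestronglyMeasurable (by fun_prop))
    (sB_integrable ν hx) (Continuous.aestronglyMeasurable (by fun_prop)) ?_
    (sB_integrable (ν + 1) (half_pos hx)) ?_).2
  · refine key.congr_deriv ?_
    unfold sB
    rw [← MeasureTheory.integral_sub (sB_integrable _ hx) (sB_integrable _ hx),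
      ← MeasureTheory.integral_div]
    congr 1; funext t
    rw [exp_shift_add, exp_shift_sub, Real.sinh_eq]; ring
  · filter_upwards [MeasureTheory.ae_restrict_mem measurableSet_Ioi] with t ht y hy
    have ht : 0 < t := ht
    have hs : 0 < Real.sinh t := Real.sinh_pos_iff.2 ht
    rw [Real.norm_eq_abs, abs_mul, abs_neg, abs_of_pos hs, abs_of_pos (Real.exp_pos _),
      exp_shift_add, mul_comm]
    have : Real.sinh t ≤ Real.exp t := by
      rw [Real.sinh_eq]; have := Real.exp_pos t; have := Real.exp_pos (-t); linarith
    have hy' : x / 2 < y := hy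
    gcongr
  · refine Eventually.of_forall fun t y _ => ?_
    have : HasDerivAt (fun y => ν * t - y * Real.sinh t) (- Real.sinh t) y := by
      refine ((hasDerivAt_const y (ν * t)).sub ((hasDerivAt_id' y).mul_const (Real.sinh t))).congr_deriv ?_
      ring
    exact this.exp

lemma sB_bdry (ν : ℝ) {x : ℝ} (hx : 0 < x) :
    ν * sB ν x - x / 2 * (sB (ν + 1) x + sB (ν - 1) x) = -1 := by
  have hd : ∀ t ∈ Ioi (0:ℝ), HasDerivAt (fun t => Real.exp (ν * t - x * Real.sinh t))
      (Real.exp (ν * t - x * Real.sinh t) * (ν - x * Real.cosh t)) t := by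
    intro t _
    have : HasDerivAt (fun t => ν * t - x * Real.sinh t) (ν - x * Real.cosh t) t := by
      refine (((hasDerivAt_id' t).const_mul ν).sub ((Real.hasDerivAt_sinh t).const_mul x)).congr_deriv ?_
      ring
    exact this.exp
  have e : (fun t => Real.exp (ν * t - x * Real.sinh t) * (ν - x * Real.cosh t)) =
    fun t => ν * Real.exp (ν * t - x * Real.sinh t) - x / 2 *
      (Real.exp ((ν + 1) * t - x * Real.sinh t) + Real.exp ((ν - 1) * t - x * Real.sinh t)) := by
    funext t
    rw [exp_shift_add, exp_shift_sub, Real.cosh_eq]; ring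
  have i1 := (sB_integrable ν hx).const_mul ν
  have i2 : MeasureTheory.IntegrableOn (fun t => x / 2 *
      (Real.exp ((ν + 1) * t - x * Real.sinh t) + Real.exp ((ν - 1) * t - x * Real.sinh t))) (Ioi 0) :=
    ((sB_integrable (ν + 1) hx).add (sB_integrable (ν - 1) hx)).const_mul (x / 2)
  have h := MeasureTheory.integral_Ioi_of_hasDerivAt_of_tendsto (a := 0)
    (Continuous.continuousWithinAt (by fun_prop)) hd (by rw [e]; exact i1.sub i2) (sB_tendsto ν hx)
  rw [e] at h
  rw [MeasureTheory.integral_sub i1 i2, MeasureTheory.integral_const_mul,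
    MeasureTheory.integral_const_mul,
    MeasureTheory.integral_add (sB_integrable _ hx) (sB_integrable _ hx)] at h
  simpa [sB] using h

lemma cexp_shift_add (ν x φ : ℝ) : Complex.exp (Complex.I * ((x * Real.sin φ - (ν + 1) * φ : ℝ) : ℂ))
    = Complex.exp (-(φ : ℂ) * Complex.I) * Complex.exp (Complex.I * ((x * Real.sin φ - ν * φ : ℝ) : ℂ)) := by
  rw [← Complex.exp_add]; congr 1; push_cast; ring

lemma cexp_shift_sub (ν x φ : ℝ) : Complex.exp (Complex.I * ((x * Real.sin φ - (ν - 1) * φ : ℝ) : ℂ))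
    = Complex.exp ((φ : ℂ) * Complex.I) * Complex.exp (Complex.I * ((x * Real.sin φ - ν * φ : ℝ) : ℂ)) := by
  rw [← Complex.exp_add]; congr 1; push_cast; ring

lemma sA_integrable (ν x : ℝ) (a b : ℝ) : IntervalIntegrable
    (fun φ : ℝ => Complex.exp (Complex.I * ((x * Real.sin φ - ν * φ : ℝ) : ℂ)))
    MeasureTheory.volume a b :=
  Continuous.intervalIntegrable (by fun_prop) _ _

lemma norm_cexp_I (r : ℝ) : ‖Complex.exp (Complex.I * (r : ℂ))‖ = 1 := by
  rw [mul_comm]; exact Complex.norm_exp_ofReal_mul_I r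

lemma hasDerivAt_sA (ν x : ℝ) : HasDerivAt (sA ν) ((sA (ν - 1) x - sA (ν + 1) x) / 2) x := by
  have key := (intervalIntegral.hasDerivAt_integral_of_dominated_loc_of_deriv_le
    (μ := MeasureTheory.volume) (a := 0) (b := π)
    (F := fun y φ => Complex.exp (Complex.I * ((y * Real.sin φ - ν * φ : ℝ) : ℂ)))
    (F' := fun y φ => Complex.exp (Complex.I * ((y * Real.sin φ - ν * φ : ℝ) : ℂ))
      * (Complex.I * ((Real.sin φ : ℝ) : ℂ)))
    (bound := fun _ => 1)
    (x₀ := x) (s := univ) univ_mem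
    (Eventually.of_forall fun y => Continuous.aestronglyMeasurable (by fun_prop))
    (sA_integrable ν x _ _) (Continuous.aestronglyMeasurable (by fun_prop)) ?_
    (by simp) ?_).2
  · refine key.congr_deriv ?_
    unfold sA
    rw [← intervalIntegral.integral_sub (sA_integrable _ _ _ _) (sA_integrable _ _ _ _),
      ← intervalIntegral.integral_div]
    congr 1; funext φ
    rw [cexp_shift_add, cexp_shift_sub, Complex.ofReal_sin, Complex.sin]
    have := Complex.I_mul_I
    linear_combination (Complex.exp (Complex.I * ((x * Real.sin φ - ν * φ : ℝ) : ℂ))) * (Complex.exp (-(φ:ℂ) * Complex.I) - Complex.exp ((φ:ℂ) * Complex.I)) / 2 * this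
  · refine Eventually.of_forall fun φ _ y _ => ?_
    rw [norm_mul, norm_cexp_I, one_mul, norm_mul, Complex.norm_I, one_mul, Complex.norm_real]
    exact Real.abs_sin_le_one φ
  · refine Eventually.of_forall fun φ _ y _ => ?_
    have h1 : HasDerivAt (fun y : ℝ => y * Real.sin φ - ν * φ) (Real.sin φ) y := by
      refine (((hasDerivAt_id' y).mul_const (Real.sin φ)).sub_const _).congr_deriv ?_
      ring
    exact (h1.ofReal_comp.const_mul Complex.I).cexp

lemma sA_bdry (ν x : ℝ) : Complex.exp (-(Complex.I * ((ν * π : ℝ) : ℂ))) - 1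
    = Complex.I * (x / 2 * (sA (ν - 1) x + sA (ν + 1) x) - ν * sA ν x) := by
  have hd : ∀ φ ∈ uIcc (0:ℝ) π, HasDerivAt
      (fun φ : ℝ => Complex.exp (Complex.I * ((x * Real.sin φ - ν * φ : ℝ) : ℂ)))
      (Complex.exp (Complex.I * ((x * Real.sin φ - ν * φ : ℝ) : ℂ)) *
        (Complex.I * ((x * Real.cos φ - ν : ℝ) : ℂ))) φ := by
    intro φ _
    have h1 : HasDerivAt (fun φ : ℝ => x * Real.sin φ - ν * φ) (x * Real.cos φ - ν) φ := by
      refine (((Real.hasDerivAt_sin φ).const_mul x).sub ((hasDerivAt_id' φ).const_mul ν)).congr_deriv ?_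
      ring
    exact (h1.ofReal_comp.const_mul Complex.I).cexp
  have h := intervalIntegral.integral_eq_sub_of_hasDerivAt hd
    (Continuous.intervalIntegrable (by fun_prop) _ _)
  have e : (fun φ : ℝ => Complex.exp (Complex.I * ((x * Real.sin φ - ν * φ : ℝ) : ℂ)) *
        (Complex.I * ((x * Real.cos φ - ν : ℝ) : ℂ))) = fun φ : ℝ =>
      Complex.I * ((x : ℂ) / 2 * (Complex.exp (Complex.I * ((x * Real.sin φ - (ν - 1) * φ : ℝ) : ℂ))
       + Complex.exp (Complex.I * ((x * Real.sin φ - (ν + 1) * φ : ℝ) : ℂ)))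
       - ν * Complex.exp (Complex.I * ((x * Real.sin φ - ν * φ : ℝ) : ℂ))) := by
    funext φ
    rw [cexp_shift_add, cexp_shift_sub]
    push_cast
    rw [Complex.cos]
    ring
  rw [e, intervalIntegral.integral_const_mul,
    intervalIntegral.integral_sub (((sA_integrable _ _ _ _).add (sA_integrable _ _ _ _)).const_mul _)
      ((sA_integrable _ _ _ _).const_mul _), intervalIntegral.integral_const_mul,
      intervalIntegral.integral_const_mul,
      intervalIntegral.integral_add (sA_integrable _ _ _ _) (sA_integrable _ _ _ _)] at h
  unfold sA
  rw [h]
  simp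

lemma cexp_phase_add (ν : ℝ) : Complex.exp (-(Complex.I * (((ν + 1) * π : ℝ) : ℂ)))
    = - Complex.exp (-(Complex.I * ((ν * π : ℝ) : ℂ))) := by
  have : -(Complex.I * (((ν + 1) * π : ℝ) : ℂ)) = -(Complex.I * ((ν * π : ℝ) : ℂ)) - π * Complex.I := by
    push_cast; ring
  rw [this, Complex.exp_sub, Complex.exp_pi_mul_I]; ring

lemma cexp_phase_sub (ν : ℝ) : Complex.exp (-(Complex.I * (((ν - 1) * π : ℝ) : ℂ)))
    = - Complex.exp (-(Complex.I * ((ν * π : ℝ) : ℂ))) := by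
  have := cexp_phase_add (ν - 1)
  rw [sub_add_cancel] at this
  rw [this]; ring

lemma hasDerivAt_hk_half (ν : ℝ) {x : ℝ} (hx : 0 < x) :
    HasDerivAt (hk ν) ((hk (ν - 1) x - hk (ν + 1) x) / 2) x := by
  have h1 := (hasDerivAt_sA ν x)
  have h2 := (hasDerivAt_sB ν hx).ofReal_comp
  have h3 := (hasDerivAt_sB (-ν) hx).ofReal_comp
  refine ((h1.sub ((h2.add (h3.const_mul (Complex.exp (-(Complex.I * ((ν * π : ℝ) : ℂ)))))).const_mul
    Complex.I)).const_mul (1 / π : ℂ)).congr_deriv ?_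
  unfold hk
  rw [cexp_phase_add, cexp_phase_sub, show -(ν + 1) = -ν - 1 by ring, show -(ν - 1) = -ν + 1 by ring]
  push_cast
  ring

lemma hk_rec (ν : ℝ) {x : ℝ} (hx : 0 < x) :
    hk (ν - 1) x + hk (ν + 1) x = 2 * ν / x * hk ν x := by
  have h1 := sA_bdry ν x
  have h2 : (ν * sB ν x - x / 2 * (sB (ν + 1) x + sB (ν - 1) x) : ℂ) = -1 := by
    exact_mod_cast sB_bdry ν hx
  have h3 : (-ν * sB (-ν) x - x / 2 * (sB (-ν + 1) x + sB (-ν - 1) x) : ℂ) = -1 := by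
    exact_mod_cast sB_bdry (-ν) hx
  have hx' : (x : ℂ) ≠ 0 := by exact_mod_cast hx.ne'
  have hp : (π : ℂ) ≠ 0 := by exact_mod_cast Real.pi_ne_zero
  unfold hk
  rw [cexp_phase_add, cexp_phase_sub, show -(ν + 1) = -ν - 1 by ring, show -(ν - 1) = -ν + 1 by ring]
  set e := Complex.exp (-(Complex.I * ((ν * π : ℝ) : ℂ)))
  field_simp
  have hI := Complex.I_mul_I
  linear_combination 2 * Complex.I * h1 + 2 * Complex.I * h2 - 2 * e * Complex.I * h3
    + (2 * ((x:ℂ) / 2 * (sA (ν - 1) x + sA (ν + 1) x) - ν * sA ν x)) * hI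

lemma hasDerivAt_hk (ν : ℝ) {x : ℝ} (hx : 0 < x) :
    HasDerivAt (hk ν) (ν / x * hk ν x - hk (ν + 1) x) x := by
  refine (hasDerivAt_hk_half ν hx).congr_deriv ?_
  have := hk_rec ν hx
  linear_combination (1/2) * this

lemma hasDerivAt_hk' (ν : ℝ) {x : ℝ} (hx : 0 < x) :
    HasDerivAt (hk ν) (hk (ν - 1) x - ν / x * hk ν x) x := by
  refine (hasDerivAt_hk_half ν hx).congr_deriv ?_
  have := hk_rec ν hx
  linear_combination (-1/2) * this

lemma sA_neg (ν x : ℝ) : sA (-ν) x = Complex.exp (Complex.I * ((ν * π : ℝ) : ℂ)) * sA ν x := by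
  unfold sA
  rw [← intervalIntegral.integral_const_mul]
  have h := intervalIntegral.integral_comp_sub_left (a := 0) (b := π)
    (fun φ : ℝ => Complex.exp (Complex.I * ((x * Real.sin φ - (-ν) * φ : ℝ) : ℂ))) π
  simp only [sub_self, sub_zero] at h
  rw [← h]
  congr 1; funext φ
  rw [← Complex.exp_add]
  congr 1
  rw [Real.sin_pi_sub]; push_cast; ring

lemma hk_neg (ν x : ℝ) : hk (-ν) x = Complex.exp (Complex.I * ((ν * π : ℝ) : ℂ)) * hk ν x := by
  unfold hk
  rw [sA_neg, neg_neg]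
  have h1 : Complex.exp (-(Complex.I * ((-ν * π : ℝ) : ℂ))) = Complex.exp (Complex.I * ((ν * π : ℝ) : ℂ)) := by
    congr 1; push_cast; ring
  have h2 : Complex.exp (Complex.I * ((ν * π : ℝ) : ℂ)) * Complex.exp (-(Complex.I * ((ν * π : ℝ) : ℂ))) = 1 := by
    rw [← Complex.exp_add]; simp
  rw [h1]
  linear_combination (-(1 / π : ℂ) * Complex.I * (sB (-ν) x)) * (-h2)

lemma continuous_sA_order (x : ℝ) : Continuous fun ν => sA ν x := by
  unfold sA
  exact intervalIntegral.continuous_parametric_intervalIntegral_of_continuous' (by fun_prop) _ _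

lemma continuous_sB_order {x : ℝ} (hx : 0 < x) : Continuous fun ν => sB ν x := by
  rw [continuous_iff_continuousAt]
  intro ν
  unfold sB
  refine MeasureTheory.continuousAt_of_dominated
    (bound := fun t => Real.exp ((ν + 1) * t - x * Real.sinh t)) ?_ ?_ (sB_integrable _ hx) ?_
  · exact Eventually.of_forall fun y => Continuous.aestronglyMeasurable (by fun_prop)
  · filter_upwards [Iio_mem_nhds (show ν < ν + 1 by linarith)] with μ hμ
    filter_upwards [MeasureTheory.ae_restrict_mem measurableSet_Ioi] with t ht
    have ht : 0 < t := ht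
    have hμ : μ < ν + 1 := hμ
    rw [Real.norm_eq_abs, abs_of_pos (Real.exp_pos _)]
    gcongr
  · exact Eventually.of_forall fun t => Continuous.continuousAt (by fun_prop)

lemma continuous_hk_order {x : ℝ} (hx : 0 < x) : Continuous fun ν => hk ν x := by
  unfold hk
  have h1 := continuous_sA_order x
  have h2 : Continuous fun ν => (sB ν x : ℂ) := Complex.continuous_ofReal.comp (continuous_sB_order hx)
  have h3 : Continuous fun ν => (sB (-ν) x : ℂ) :=
    Complex.continuous_ofReal.comp ((continuous_sB_order hx).comp continuous_neg)
  fun_prop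

/-! ### calculus helpers on `(0, ∞)` -/

lemma mono_Ioi {f f' : ℝ → ℝ} (hd : ∀ x, 0 < x → HasDerivAt f (f' x) x)
    (h : ∀ x, 0 < x → 0 ≤ f' x) : MonotoneOn f (Ioi 0) := by
  refine monotoneOn_of_hasDerivWithinAt_nonneg (f' := f') (convex_Ioi 0)
    (fun x hx => (hd x hx).continuousAt.continuousWithinAt) ?_ ?_
  · intro x hx; rw [interior_Ioi] at hx; exact (hd x hx).hasDerivWithinAt
  · intro x hx; rw [interior_Ioi] at hx; exact h x hx

lemma anti_Ioi {f f' : ℝ → ℝ} (hd : ∀ x, 0 < x → HasDerivAt f (f' x) x)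
    (h : ∀ x, 0 < x → f' x ≤ 0) : AntitoneOn f (Ioi 0) := by
  have := mono_Ioi (f := fun x => - f x) (f' := fun x => - f' x) (fun x hx => (hd x hx).neg)
    (fun x hx => by linarith [h x hx])
  intro a ha b hb hab
  have := this ha hb hab
  simp only at this
  linarith

lemma const_Ioi {f : ℝ → ℝ} (hd : ∀ x, 0 < x → HasDerivAt f 0 x) {x y : ℝ} (hx : 0 < x)
    (hy : 0 < y) : f x = f y := by
  have h1 := mono_Ioi hd (fun _ _ => le_rfl)
  have h2 := anti_Ioi hd (fun _ _ => le_rfl)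
  rcases le_total x y with h | h
  · exact le_antisymm (h1 hx hy h) (h2 hx hy h)
  · exact le_antisymm (h2 hy hx h) (h1 hy hx h)

/-- value of a constant from its limit at `0+` -/
lemma const_Ioi_lim {f : ℝ → ℝ} (hd : ∀ x, 0 < x → HasDerivAt f 0 x) {c : ℝ}
    (hl : Tendsto f (𝓝[>] 0) (𝓝 c)) {x : ℝ} (hx : 0 < x) : f x = c := by
  refine tendsto_nhds_unique (tendsto_const_nhds.congr' ?_) hl
  filter_upwards [self_mem_nhdsWithin] with y hy
  exact const_Ioi hd hx hy

/-- a nonincreasing function on `(0, ∞)` is bounded by its limit at `0+` -/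
lemma anti_le_lim {f : ℝ → ℝ} (h : AntitoneOn f (Ioi 0)) {c : ℝ}
    (hl : Tendsto f (𝓝[>] 0) (𝓝 c)) {x : ℝ} (hx : 0 < x) : f x ≤ c := by
  refine ge_of_tendsto hl ?_
  filter_upwards [Ioo_mem_nhdsGT hx] with y hy
  exact h hy.1 hx hy.2.le

lemma mono_ge_lim {f : ℝ → ℝ} (h : MonotoneOn f (Ioi 0)) {c : ℝ}
    (hl : Tendsto f (𝓝[>] 0) (𝓝 c)) {x : ℝ} (hx : 0 < x) : c ≤ f x := by
  refine le_of_tendsto hl ?_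
  filter_upwards [Ioo_mem_nhdsGT hx] with y hy
  exact h hy.1 hx hy.2.le

lemma hasDerivAt_re {f : ℝ → ℂ} {f' : ℂ} {x : ℝ} (h : HasDerivAt f f' x) :
    HasDerivAt (fun x => (f x).re) f'.re x := Complex.reCLM.hasFDerivAt.comp_hasDerivAt x h

lemma hasDerivAt_im {f : ℝ → ℂ} {f' : ℂ} {x : ℝ} (h : HasDerivAt f f' x) :
    HasDerivAt (fun x => (f x).im) f'.im x := Complex.imCLM.hasFDerivAt.comp_hasDerivAt x h

/-! ### real part of the Hankel function -/

noncomputable def gR (ν x : ℝ) : ℝ := (hk ν x).re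
noncomputable def gI (ν x : ℝ) : ℝ := (hk ν x).im

lemma gR_formula (ν x : ℝ) : gR ν x = 1 / π * ((sA ν x).re - Real.sin (ν * π) * sB (-ν) x) := by
  unfold gR hk
  have : Complex.exp (-(Complex.I * ((ν * π : ℝ) : ℂ))) = ((Real.cos (ν * π) : ℝ) : ℂ) -
      ((Real.sin (ν * π) : ℝ) : ℂ) * Complex.I := by
    rw [show -(Complex.I * ((ν * π : ℝ) : ℂ)) = (((-(ν * π) : ℝ)) : ℂ) * Complex.I by push_cast; ring,
      Complex.exp_mul_I, ← Complex.ofReal_cos, ← Complex.ofReal_sin, Real.cos_neg, Real.sin_neg]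
    push_cast; ring
  rw [this, show (1 / π : ℂ) = ((1 / π : ℝ) : ℂ) by push_cast; rfl, Complex.re_ofReal_mul]
  generalize Real.cos (ν * π) = c
  generalize Real.sin (ν * π) = s
  simp

lemma gI_formula (ν x : ℝ) : gI ν x = 1 / π * ((sA ν x).im - sB ν x - Real.cos (ν * π) * sB (-ν) x) := by
  unfold gI hk
  have : Complex.exp (-(Complex.I * ((ν * π : ℝ) : ℂ))) = ((Real.cos (ν * π) : ℝ) : ℂ) -
      ((Real.sin (ν * π) : ℝ) : ℂ) * Complex.I := by
    rw [show -(Complex.I * ((ν * π : ℝ) : ℂ)) = (((-(ν * π) : ℝ)) : ℂ) * Complex.I by push_cast; ring,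
      Complex.exp_mul_I, ← Complex.ofReal_cos, ← Complex.ofReal_sin, Real.cos_neg, Real.sin_neg]
    push_cast; ring
  rw [this, show (1 / π : ℂ) = ((1 / π : ℝ) : ℂ) by push_cast; rfl, Complex.im_ofReal_mul]
  generalize Real.cos (ν * π) = c
  generalize Real.sin (ν * π) = s
  simp
  ring

lemma norm_sA_le (ν x : ℝ) : ‖sA ν x‖ ≤ π := by
  unfold sA
  have := intervalIntegral.norm_integral_le_of_norm_le_const (a := 0) (b := π) (C := 1)
    (f := fun φ : ℝ => Complex.exp (Complex.I * ((x * Real.sin φ - ν * φ : ℝ) : ℂ)))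
    (fun φ _ => (norm_cexp_I _).le)
  simpa [abs_of_pos Real.pi_pos] using this

lemma sB_nonneg (ν x : ℝ) : 0 ≤ sB ν x :=
  MeasureTheory.integral_nonneg fun _ => (Real.exp_pos _).le

lemma sB_neg_le {ν x : ℝ} (hν : 0 < ν) (hx : 0 < x) : sB (-ν) x ≤ 1 / ν := by
  have h1 : sB (-ν) x ≤ ∫ t in Ioi (0:ℝ), Real.exp ((-ν) * t) := by
    refine MeasureTheory.setIntegral_mono_on (sB_integrable _ hx)
      (integrableOn_exp_mul_Ioi (by linarith) 0) measurableSet_Ioi ?_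
    intro t ht
    have : 0 < Real.sinh t := Real.sinh_pos_iff.2 ht
    refine Real.exp_le_exp.2 ?_
    nlinarith
  rw [integral_exp_mul_Ioi (by linarith)] at h1
  simpa using h1

lemma gR_bounded {ν x : ℝ} (hν : 0 < ν) (hx : 0 < x) : |gR ν x| ≤ 1 + 1 / (π * ν) := by
  rw [gR_formula, abs_mul, abs_of_pos (show 0 < 1 / π by positivity)]
  have h1 : |(sA ν x).re| ≤ π := (Complex.abs_re_le_norm _).trans (norm_sA_le _ _)
  have h2 : |Real.sin (ν * π) * sB (-ν) x| ≤ 1 / ν := by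
    rw [abs_mul, abs_of_nonneg (sB_nonneg _ _)]
    calc _ ≤ 1 * sB (-ν) x := by gcongr; exact sB_nonneg _ _; exact Real.abs_sin_le_one _
      _ ≤ _ := by rw [one_mul]; exact sB_neg_le hν hx
  have h3 := abs_sub (sA ν x).re (Real.sin (ν * π) * sB (-ν) x)
  calc 1 / π * |(sA ν x).re - Real.sin (ν * π) * sB (-ν) x| ≤ 1 / π * (π + 1 / ν) := by
        gcongr; linarith
    _ = _ := by field_simp

lemma gR_rec (ν : ℝ) {x : ℝ} (hx : 0 < x) : gR (ν - 1) x + gR (ν + 1) x = 2 * ν / x * gR ν x := by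
  have h := congrArg Complex.re (hk_rec ν hx)
  rw [show (2 * ν / x : ℂ) = ((2 * ν / x : ℝ) : ℂ) by push_cast; rfl, Complex.re_ofReal_mul] at h
  exact h

lemma hasDerivAt_gR (ν : ℝ) {x : ℝ} (hx : 0 < x) :
    HasDerivAt (gR ν) (ν / x * gR ν x - gR (ν + 1) x) x := by
  refine (hasDerivAt_re (hasDerivAt_hk ν hx)).congr_deriv ?_
  rw [show (ν / x : ℂ) = ((ν / x : ℝ) : ℂ) by push_cast; rfl, Complex.sub_re, Complex.re_ofReal_mul]
  rfl

lemma hasDerivAt_gI (ν : ℝ) {x : ℝ} (hx : 0 < x) :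
    HasDerivAt (gI ν) (ν / x * gI ν x - gI (ν + 1) x) x := by
  refine (hasDerivAt_im (hasDerivAt_hk ν hx)).congr_deriv ?_
  rw [show (ν / x : ℂ) = ((ν / x : ℝ) : ℂ) by push_cast; rfl, Complex.sub_im, Complex.im_ofReal_mul]
  rfl

lemma gI_rec (ν : ℝ) {x : ℝ} (hx : 0 < x) : gI (ν - 1) x + gI (ν + 1) x = 2 * ν / x * gI ν x := by
  have h := congrArg Complex.im (hk_rec ν hx)
  rw [show (2 * ν / x : ℂ) = ((2 * ν / x : ℝ) : ℂ) by push_cast; rfl, Complex.im_ofReal_mul] at h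
  exact h

lemma up_deriv {f : ℝ → ℝ → ℝ} (ν : ℝ) {x : ℝ}
    (hr : f ν x + f (ν + 2) x = 2 * (ν + 1) / x * f (ν + 1) x)
    (hd : HasDerivAt (f (ν + 1)) ((ν + 1) / x * f (ν + 1) x - f (ν + 1 + 1) x) x) :
    HasDerivAt (f (ν + 1)) (f ν x - (ν + 1) / x * f (ν + 1) x) x := by
  refine hd.congr_deriv ?_
  rw [show ν + 1 + 1 = ν + 2 by ring]
  have : 2 * (ν + 1) / x = 2 * ((ν + 1) / x) := by ring
  rw [this] at hr
  linarith

lemma hasDerivAt_gR_up (ν : ℝ) {x : ℝ} (hx : 0 < x) :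
    HasDerivAt (gR (ν + 1)) (gR ν x - (ν + 1) / x * gR (ν + 1) x) x := by
  refine up_deriv ν ?_ (hasDerivAt_gR _ hx)
  have := gR_rec (ν + 1) hx
  rwa [add_sub_cancel_right, show ν + 1 + 1 = ν + 2 by ring] at this

lemma hasDerivAt_gI_up (ν : ℝ) {x : ℝ} (hx : 0 < x) :
    HasDerivAt (gI (ν + 1)) (gI ν x - (ν + 1) / x * gI (ν + 1) x) x := by
  refine up_deriv ν ?_ (hasDerivAt_gI _ hx)
  have := gI_rec (ν + 1) hx
  rwa [add_sub_cancel_right, show ν + 1 + 1 = ν + 2 by ring] at this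

lemma hasDerivAt_besselJ_up (ν : ℝ) {x : ℝ} (hx : 0 < x) :
    HasDerivAt (besselJ (ν + 1)) (besselJ ν x - (ν + 1) / x * besselJ (ν + 1) x) x := by
  refine up_deriv ν ?_ (hasDerivAt_besselJ hx)
  have := besselJ_rec (ν := ν + 1) hx
  rwa [add_sub_cancel_right, show ν + 1 + 1 = ν + 2 by ring] at this

/-- Casoratian of two solution families is constant -/
lemma casorati {a b a' b' : ℝ → ℝ} {ν x : ℝ} (hx : 0 < x)
    (ha : HasDerivAt a (ν / x * a x - a' x) x) (hb : HasDerivAt b (ν / x * b x - b' x) x)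
    (ha' : HasDerivAt a' (a x - (ν + 1) / x * a' x) x)
    (hb' : HasDerivAt b' (b x - (ν + 1) / x * b' x) x) :
    HasDerivAt (fun x => x * (a' x * b x - a x * b' x)) 0 x := by
  refine ((hasDerivAt_id' x).mul ((ha'.mul hb).sub (ha.mul hb'))).congr_deriv ?_
  simp only [Pi.mul_apply, Pi.sub_apply]
  field_simp
  ring

lemma gRJ_cross {ν x : ℝ} (hν : 0 < ν) (hx : 0 < x) :
    gR (ν + 1) x * besselJ ν x = gR ν x * besselJ (ν + 1) x := by
  have h := const_Ioi_lim (f := fun x => x * (gR (ν + 1) x * besselJ ν x - gR ν x * besselJ (ν + 1) x))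
    (c := 0) (fun y hy => casorati hy (hasDerivAt_gR ν hy) (hasDerivAt_besselJ hy)
      (hasDerivAt_gR_up ν hy) (hasDerivAt_besselJ_up ν hy)) ?_ hx
  · have := (mul_eq_zero.1 h).resolve_left hx.ne'
    linarith
  · have hx0 : Tendsto (fun x : ℝ => x) (𝓝[>] 0) (𝓝 0) := tendsto_id.mono_left nhdsWithin_le_nhds
    have b1 : IsBoundedUnder (· ≤ ·) (𝓝[>] (0:ℝ)) (fun x => ‖gR (ν + 1) x‖) :=
      isBoundedUnder_of_eventually_le (a := 1 + 1 / (π * (ν + 1))) (by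
        filter_upwards [self_mem_nhdsWithin] with x hx
        exact gR_bounded (by linarith) hx)
    have b2 : IsBoundedUnder (· ≤ ·) (𝓝[>] (0:ℝ)) (fun x => ‖gR ν x‖) :=
      isBoundedUnder_of_eventually_le (a := 1 + 1 / (π * ν)) (by
        filter_upwards [self_mem_nhdsWithin] with x hx
        exact gR_bounded hν hx)
    have t1 := (besselJ_tendsto_zero hν).zero_mul_isBoundedUnder_le b1
    have t2 := (besselJ_tendsto_zero (show 0 < ν + 1 by linarith)).zero_mul_isBoundedUnder_le b2
    have := hx0.mul (t1.sub t2)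
    simp only [sub_self, mul_zero] at this
    refine this.congr ?_
    intro x; ring

/-! ### the scaled limit of `sB` -/

lemma gamma_tail {σ x : ℝ} (hx : 0 < x) :
    (x / 2) ^ σ * ∫ t in Ioi (0:ℝ), Real.exp (σ * t - x / 2 * Real.exp t)
      = ∫ s in Ioi (x / 2), Real.exp (-s) * s ^ (σ - 1) := by
  have hx2 : 0 < x / 2 := by positivity
  have h1 := MeasureTheory.integral_comp_exp_Ioi
    (fun y => Real.exp (-(x / 2 * y)) * y ^ (σ - 1)) 0
  have h2 := MeasureTheory.integral_comp_mul_left_Ioi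
    (fun s : ℝ => Real.exp (-s) * s ^ (σ - 1)) 1 hx2
  have e1 : (fun t => Real.exp t • (Real.exp (-(x / 2 * Real.exp t)) * (Real.exp t) ^ (σ - 1)))
      = fun t => Real.exp (σ * t - x / 2 * Real.exp t) := by
    funext t
    rw [← Real.exp_mul, smul_eq_mul, ← Real.exp_add, ← Real.exp_add]
    congr 1; ring
  rw [e1, Real.exp_zero] at h1
  rw [h1]
  have e2 : ∫ y in Ioi (1:ℝ), Real.exp (-(x / 2 * y)) * (x / 2 * y) ^ (σ - 1)
     = (x / 2) ^ (σ - 1) * ∫ y in Ioi (1:ℝ), Real.exp (-(x / 2 * y)) * y ^ (σ - 1) := by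
    rw [← MeasureTheory.integral_const_mul]
    refine MeasureTheory.setIntegral_congr_fun measurableSet_Ioi ?_
    intro y hy
    have hy : (1:ℝ) < y := hy
    simp only
    rw [Real.mul_rpow hx2.le (by linarith)]; ring
  rw [e2, mul_one, smul_eq_mul, Real.rpow_sub_one hx2.ne'] at h2
  have : (x / 2) ^ σ / (x / 2) = (x/2)⁻¹ * (x / 2) ^ σ := by ring
  rw [this, mul_assoc] at h2
  exact mul_left_cancel₀ (inv_ne_zero hx2.ne') h2

lemma expexp_integrable (σ : ℝ) {x : ℝ} (hx : 0 < x) :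
    MeasureTheory.IntegrableOn (fun t => Real.exp (σ * t - x / 2 * Real.exp t)) (Ioi 0) := by
  refine MeasureTheory.Integrable.mono' (sB_integrable σ hx)
    (Continuous.aestronglyMeasurable (by fun_prop)) ?_
  refine Eventually.of_forall fun t => ?_
  rw [Real.norm_eq_abs, abs_of_pos (Real.exp_pos _)]
  refine Real.exp_le_exp.2 ?_
  rw [Real.sinh_eq]
  have := Real.exp_pos (-t)
  nlinarith

lemma sB_scaled_tendsto {σ : ℝ} (hσ : 0 < σ) :
    Tendsto (fun x => (x / 2) ^ σ * sB σ x) (𝓝[>] 0) (𝓝 (Real.Gamma σ)) := by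
  have hx0 : Tendsto (fun x : ℝ => x / 2) (𝓝[>] 0) (𝓝 0) := by
    have : Continuous fun x : ℝ => x / 2 := by fun_prop
    have h2 := this.tendsto 0
    rw [zero_div] at h2
    exact h2.mono_left nhdsWithin_le_nhds
  have hG : Tendsto (fun x : ℝ => ∫ s in Ioi (x / 2), Real.exp (-s) * s ^ (σ - 1)) (𝓝[>] 0)
      (𝓝 (Real.Gamma σ)) := by
    have h := (MeasureTheory.aecover_Ioi_of_Ioi (μ := MeasureTheory.volume) hx0).integral_tendsto_of_countably_generated
      (Real.GammaIntegral_convergent hσ)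
    rw [← Real.Gamma_eq_integral hσ] at h
    refine h.congr' ?_
    filter_upwards [self_mem_nhdsWithin] with x hx
    have hx : 0 < x := hx
    rw [MeasureTheory.Measure.restrict_restrict measurableSet_Ioi, Ioi_inter_Ioi,
      max_eq_left (by positivity)]
  have hE : Tendsto (fun x : ℝ => Real.exp (x / 2) * ∫ s in Ioi (x / 2), Real.exp (-s) * s ^ (σ - 1))
      (𝓝[>] 0) (𝓝 (Real.Gamma σ)) := by
    have := ((Real.continuous_exp.tendsto 0).comp hx0).mul hG
    simpa using this
  refine tendsto_of_tendsto_of_tendsto_of_le_of_le' hG hE ?_ ?_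
  · filter_upwards [self_mem_nhdsWithin] with x hx
    have hx : 0 < x := hx
    rw [← gamma_tail hx]
    refine mul_le_mul_of_nonneg_left ?_ (by positivity)
    refine MeasureTheory.setIntegral_mono_on (expexp_integrable σ hx) (sB_integrable σ hx)
      measurableSet_Ioi ?_
    intro t _
    refine Real.exp_le_exp.2 ?_
    rw [Real.sinh_eq]
    have := Real.exp_pos (-t)
    nlinarith
  · filter_upwards [self_mem_nhdsWithin] with x hx
    have hx : 0 < x := hx
    rw [← gamma_tail hx, ← mul_assoc, mul_comm (Real.exp (x / 2)), mul_assoc]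
    refine mul_le_mul_of_nonneg_left ?_ (by positivity)
    rw [← MeasureTheory.integral_const_mul]
    refine MeasureTheory.setIntegral_mono_on (sB_integrable σ hx)
      ((expexp_integrable σ hx).const_mul _) measurableSet_Ioi ?_
    intro t ht
    rw [← Real.exp_add]
    refine Real.exp_le_exp.2 ?_
    rw [Real.sinh_eq]
    have : Real.exp (-t) ≤ 1 := Real.exp_le_one_iff.2 (by linarith [show (0:ℝ) < t from ht])
    nlinarith

lemma half_rpow_tendsto {ν : ℝ} (hν : 0 < ν) : Tendsto (fun x : ℝ => (x / 2) ^ ν) (𝓝[>] 0) (𝓝 0) := by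
  have : Continuous fun x : ℝ => (x / 2) ^ ν :=
    (continuous_id.div_const 2).rpow_const (fun _ => Or.inr hν.le)
  have h2 := this.tendsto 0
  rw [zero_div, Real.zero_rpow hν.ne'] at h2
  exact h2.mono_left nhdsWithin_le_nhds

lemma gR_scaled_tendsto {ν : ℝ} (h0 : 0 < ν) (h1 : ν ≤ 1) :
    Tendsto (fun x => (x / 2) ^ (-(ν - 1)) * gR (ν - 1) x) (𝓝[>] 0) (𝓝 ((Real.Gamma (ν - 1 + 1))⁻¹)) := by
  rw [sub_add_cancel]
  rcases h1.lt_or_eq with h | h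
  · have hσ : 0 < 1 - ν := by linarith
    have b1 : IsBoundedUnder (· ≤ ·) (𝓝[>] (0:ℝ)) (fun x => ‖(sA (ν - 1) x).re‖) :=
      isBoundedUnder_of_eventually_le (a := π) (Eventually.of_forall fun x =>
        (Complex.abs_re_le_norm _).trans (norm_sA_le _ _))
    have t1 := (half_rpow_tendsto hσ).zero_mul_isBoundedUnder_le b1
    have t2 := (sB_scaled_tendsto hσ).const_mul (Real.sin ((ν - 1) * π))
    have t3 := (t1.sub t2).const_mul (1 / π)
    have e : 1 / π * (0 - Real.sin ((ν - 1) * π) * Real.Gamma (1 - ν)) = (Real.Gamma ν)⁻¹ := by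
      have hr := Real.Gamma_mul_Gamma_one_sub ν
      have hs : 0 < Real.sin (π * ν) := Real.sin_pos_of_pos_of_lt_pi (by positivity) (by nlinarith [Real.pi_pos])
      have hg := Real.Gamma_pos_of_pos h0
      have : Real.sin ((ν - 1) * π) = - Real.sin (π * ν) := by
        rw [show (ν - 1) * π = π * ν - π by ring, Real.sin_sub_pi]
      rw [this]
      have hp := Real.pi_pos
      rw [eq_div_iff hs.ne'] at hr
      field_simp
      linear_combination hr
    rw [e] at t3
    refine t3.congr ?_
    intro x
    rw [gR_formula, show -(ν - 1) = 1 - ν by ring]; ring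
  · subst h
    simp only [sub_self, neg_zero, Real.rpow_zero, one_mul, Real.Gamma_one, inv_one]
    have hc : Tendsto (fun x => (sA 0 x).re) (𝓝[>] 0) (𝓝 π) := by
      have := (Complex.continuous_re.continuousAt.comp (hasDerivAt_sA 0 0).continuousAt).tendsto
      have e : (sA 0 0).re = π := by simp [sA]
      simp only [Function.comp_apply, Function.comp_def, e] at this
      exact this.mono_left nhdsWithin_le_nhds
    have := hc.const_mul (1 / π)
    rw [one_div_mul_cancel Real.pi_ne_zero] at this
    refine this.congr ?_
    intro x
    rw [gR_formula]; simp

lemma besselJ_pos_near {ν : ℝ} (hν : -1 < ν) : ∀ᶠ x in 𝓝[>] (0:ℝ), 0 < besselJ ν x := by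
  have h := besselJ_tendsto_scaled ν
  have hg : 0 < (Real.Gamma (ν + 1))⁻¹ := inv_pos.2 (Real.Gamma_pos_of_pos (by linarith))
  filter_upwards [h.eventually (lt_mem_nhds hg), self_mem_nhdsWithin] with x hx hx0
  have hx0 : 0 < x := hx0
  have : 0 < (x / 2) ^ (-ν) := by positivity
  exact (mul_pos_iff_of_pos_left this).1 hx

lemma gR_eq_J_base {ν : ℝ} (h0 : 0 < ν) (h1 : ν ≤ 1) {x : ℝ} (hx : 0 < x) :
    gR ν x = besselJ ν x ∧ gR (ν + 1) x = besselJ (ν + 1) x := by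
  set ρ : ℝ → ℝ := fun x => gR (ν - 1) x / besselJ (ν - 1) x with hρ
  have hρ1 : Tendsto ρ (𝓝[>] 0) (𝓝 1) := by
    have hg : (Real.Gamma (ν - 1 + 1))⁻¹ ≠ 0 :=
      (inv_pos.2 (Real.Gamma_pos_of_pos (by linarith))).ne'
    have := (gR_scaled_tendsto h0 h1).div (besselJ_tendsto_scaled (ν - 1)) hg
    rw [div_self hg] at this
    refine this.congr' ?_
    filter_upwards [self_mem_nhdsWithin] with x hx
    have hx : 0 < x := hx
    have : (x / 2) ^ (-(ν - 1)) ≠ 0 := by positivity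
    simp only [Pi.div_apply, hρ]
    rw [mul_div_mul_left _ _ this]
  have hev : ∀ᶠ x in 𝓝[>] (0:ℝ), gR ν x = ρ x * besselJ ν x ∧
      gR (ν + 1) x = ρ x * besselJ (ν + 1) x := by
    filter_upwards [besselJ_pos_near (show -1 < ν - 1 by linarith),
      besselJ_pos_near (show -1 < ν by linarith), self_mem_nhdsWithin] with x p1 p2 hx
    have hx : 0 < x := hx
    have c := gRJ_cross h0 hx
    have r1 := gR_rec ν hx
    have r2 := besselJ_rec (ν := ν) hx
    have e1 : gR ν x = ρ x * besselJ ν x := by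
      simp only [hρ]
      field_simp
      have a1 : gR (ν - 1) x = 2 * ν / x * gR ν x - gR (ν + 1) x := by linarith
      have a2 : besselJ (ν - 1) x = 2 * ν / x * besselJ ν x - besselJ (ν + 1) x := by linarith
      rw [a1, a2]
      linear_combination c
    refine ⟨e1, ?_⟩
    rw [e1] at c
    refine mul_right_cancel₀ p2.ne' ?_
    rw [c]; ring
  -- scaled differences
  set S : ℝ → ℝ := fun x => ((x / 2) ^ (-ν) * (gR ν x - besselJ ν x)) ^ 2 +
    ((x / 2) ^ (-ν) * (gR (ν + 1) x - besselJ (ν + 1) x)) ^ 2 with hS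
  have hS0 : Tendsto S (𝓝[>] 0) (𝓝 0) := by
    have t0 : Tendsto (fun x => ρ x - 1) (𝓝[>] 0) (𝓝 0) := by simpa using hρ1.sub_const 1
    have t1 := t0.mul (besselJ_tendsto_scaled ν)
    have hx0 : Tendsto (fun x : ℝ => x / 2) (𝓝[>] 0) (𝓝 0) := by
      simpa using half_rpow_tendsto one_pos
    have t2 := t0.mul (hx0.mul (besselJ_tendsto_scaled (ν + 1)))
    have t3 := (t1.pow 2).add (t2.pow 2)
    simp only [zero_mul, ne_eq, OfNat.ofNat_ne_zero, not_false_eq_true, zero_pow, add_zero] at t3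
    refine t3.congr' ?_
    filter_upwards [hev, self_mem_nhdsWithin] with x h hx
    have hx : 0 < x := hx
    simp only [hS]
    rw [h.1, h.2, show -(ν + 1) = -ν - 1 by ring, Real.rpow_sub_one (by positivity)]
    field_simp
  have hanti : AntitoneOn S (Ioi 0) := by
    refine anti_Ioi (f' := fun x => - (2 * (2 * ν + 1) / x *
      ((x / 2) ^ (-ν) * (gR (ν + 1) x - besselJ (ν + 1) x)) ^ 2)) ?_ ?_
    · intro x hx
      have hx2 : 0 < x / 2 := by positivity
      have p : HasDerivAt (fun z : ℝ => (z / 2) ^ (-ν)) ((1 / 2) * (-ν) * (x / 2) ^ (-ν - 1)) x :=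
        ((hasDerivAt_id x).div_const 2).rpow_const (Or.inl hx2.ne')
      have d1 := (hasDerivAt_gR ν hx).sub (hasDerivAt_besselJ (ν := ν) hx)
      have d2 := (hasDerivAt_gR_up ν hx).sub (hasDerivAt_besselJ_up ν hx)
      refine (((p.mul d1).pow 2).add ((p.mul d2).pow 2)).congr_deriv ?_
      simp only [Pi.mul_apply, Pi.sub_apply]
      rw [Real.rpow_sub_one (by positivity)]
      field_simp
      ring
    · intro x hx
      have : 0 ≤ 2 * (2 * ν + 1) / x *
        ((x / 2) ^ (-ν) * (gR (ν + 1) x - besselJ (ν + 1) x)) ^ 2 := by positivity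
      linarith
  have hle := anti_le_lim hanti hS0 hx
  have hp : 0 < (x / 2) ^ (-ν) := by positivity
  simp only [hS] at hle
  have q1 := sq_nonneg ((x / 2) ^ (-ν) * (gR ν x - besselJ ν x))
  have q2 := sq_nonneg ((x / 2) ^ (-ν) * (gR (ν + 1) x - besselJ (ν + 1) x))
  have z1 : ((x / 2) ^ (-ν) * (gR ν x - besselJ ν x)) ^ 2 = 0 := by linarith
  have z2 : ((x / 2) ^ (-ν) * (gR (ν + 1) x - besselJ (ν + 1) x)) ^ 2 = 0 := by linarith
  rw [sq_eq_zero_iff, mul_eq_zero] at z1 z2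
  exact ⟨by linarith [z1.resolve_left hp.ne'], by linarith [z2.resolve_left hp.ne']⟩

lemma gR_eq_J (ν : ℝ) {x : ℝ} (hx : 0 < x) : gR ν x = besselJ ν x := by
  have up : ∀ μ : ℝ, 0 < μ → μ ≤ 1 → ∀ n : ℕ, gR (μ + n) x = besselJ (μ + n) x ∧
      gR (μ + n + 1) x = besselJ (μ + n + 1) x := by
    intro μ h0 h1 n
    induction n with
    | zero => simpa using gR_eq_J_base h0 h1 hx
    | succ n ih =>
      push_cast
      rw [← add_assoc]
      refine ⟨ih.2, ?_⟩
      have r1 := gR_rec (μ + n + 1) hx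
      have r2 := besselJ_rec (ν := μ + n + 1) hx
      rw [add_sub_cancel_right] at r1 r2
      rw [ih.1, ih.2] at r1
      linarith
  have down : ∀ μ : ℝ, 0 < μ → μ ≤ 1 → ∀ n : ℕ, gR (μ - n) x = besselJ (μ - n) x ∧
      gR (μ - n + 1) x = besselJ (μ - n + 1) x := by
    intro μ h0 h1 n
    induction n with
    | zero => simpa using gR_eq_J_base h0 h1 hx
    | succ n ih =>
      push_cast
      rw [← sub_sub, sub_add_cancel]
      refine ⟨?_, ih.1⟩
      have r1 := gR_rec (μ - n) hx
      have r2 := besselJ_rec (ν := μ - n) hx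
      rw [ih.1, ih.2] at r1
      linarith
  set k : ℤ := ⌈ν⌉ - 1 with hk
  have a1 := Int.ceil_lt_add_one ν
  have a2 := Int.le_ceil ν
  have b1 : 0 < ν - k := by rw [hk]; push_cast; linarith
  have b2 : ν - k ≤ 1 := by rw [hk]; push_cast; linarith
  obtain ⟨n, hn | hn⟩ := Int.eq_nat_or_neg k
  · have := (up (ν - k) b1 b2 n).1
    rwa [hn, Int.cast_natCast, sub_add_cancel] at this
  · have := (down (ν - k) b1 b2 n).1
    rwa [hn, Int.cast_neg, Int.cast_natCast, sub_neg_eq_add, add_sub_cancel_right] at this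

lemma gR_neg (ν x : ℝ) : gR (-ν) x = Real.cos (ν * π) * gR ν x - Real.sin (ν * π) * gI ν x := by
  unfold gR gI
  rw [hk_neg, mul_comm Complex.I, Complex.exp_mul_I, ← Complex.ofReal_cos, ← Complex.ofReal_sin]
  generalize Real.cos (ν * π) = c
  generalize Real.sin (ν * π) = s
  simp

lemma sin_ne_of_nonint {μ : ℝ} (h : ∀ n : ℤ, μ ≠ (n : ℝ)) : Real.sin (μ * π) ≠ 0 := by
  intro h0
  obtain ⟨n, hn⟩ := Real.sin_eq_zero_iff.1 h0
  exact h n (mul_right_cancel₀ Real.pi_ne_zero hn.symm)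

lemma nonint_eq : {μ : ℝ | ∀ n : ℤ, μ ≠ (n : ℝ)} = (range (fun n : ℤ => (n : ℝ)))ᶜ := by
  ext μ; simp [eq_comm]

lemma nonint_dense : Dense {μ : ℝ | ∀ n : ℤ, μ ≠ (n : ℝ)} := by
  rw [nonint_eq]
  exact (countable_range _).dense_compl ℝ

lemma gI_eq_Y (ν : ℝ) {x : ℝ} (hx : 0 < x) : besselY ν x = gI ν x := by
  unfold besselY
  have hb : (𝓝[{μ : ℝ | ∀ n : ℤ, μ ≠ (n : ℝ)}] ν).NeBot :=
    mem_closure_iff_nhdsWithin_neBot.1 (nonint_dense ν)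
  refine Tendsto.limUnder_eq ?_
  have hc : Tendsto (fun μ => gI μ x) (𝓝[{μ : ℝ | ∀ n : ℤ, μ ≠ (n : ℝ)}] ν) (𝓝 (gI ν x)) :=
    ((Complex.continuous_im.comp (continuous_hk_order hx)).tendsto ν).mono_left nhdsWithin_le_nhds
  refine hc.congr' ?_
  filter_upwards [self_mem_nhdsWithin] with μ hμ
  have hs := sin_ne_of_nonint hμ
  rw [← gR_eq_J _ hx, ← gR_eq_J _ hx, gR_neg]
  field_simp
  ring

/-- Wronskian -/
lemma wron (ν : ℝ) {x : ℝ} (hx : 0 < x) :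
    x * (gR (ν + 1) x * gI ν x - gR ν x * gI (ν + 1) x) = 2 / π := by
  have hgen : ∀ ν : ℝ, (∀ n : ℤ, ν ≠ (n : ℝ)) →
      x * (gR (ν + 1) x * gI ν x - gR ν x * gI (ν + 1) x) = 2 / π := by
    intro ν hν
    have hs := sin_ne_of_nonint hν
    refine const_Ioi_lim (f := fun x => x * (gR (ν + 1) x * gI ν x - gR ν x * gI (ν + 1) x))
      (fun y hy => casorati hy (hasDerivAt_gR ν hy) (hasDerivAt_gI ν hy)
      (hasDerivAt_gR_up ν hy) (hasDerivAt_gI_up ν hy)) ?_ hx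
    have hx0 : Tendsto (fun x : ℝ => x / 2) (𝓝[>] 0) (𝓝 0) := by
      simpa using half_rpow_tendsto one_pos
    have t1 := (besselJ_tendsto_scaled ν).mul (besselJ_tendsto_scaled (-ν - 1))
    have t2 := (hx0.pow 2).mul ((besselJ_tendsto_scaled (-ν)).mul (besselJ_tendsto_scaled (ν + 1)))
    have t3 := (t1.add t2).const_mul (-2 / Real.sin (ν * π))
    have e : -2 / Real.sin (ν * π) * ((Real.Gamma (ν + 1))⁻¹ * (Real.Gamma (-ν - 1 + 1))⁻¹
        + 0 ^ 2 * ((Real.Gamma (-ν + 1))⁻¹ * (Real.Gamma (ν + 1 + 1))⁻¹)) = 2 / π := by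
      have hr := Real.Gamma_mul_Gamma_one_sub (-ν)
      rw [sub_neg_eq_add, add_comm 1 ν, mul_neg, Real.sin_neg, mul_comm π ν] at hr
      rw [sub_add_cancel, ← mul_inv, mul_comm (Real.Gamma (ν + 1)), hr]
      have hp := Real.pi_pos
      field_simp
      ring
    rw [e] at t3
    refine t3.congr' ?_
    filter_upwards [self_mem_nhdsWithin] with y hy
    have hy : 0 < y := hy
    have hy2 : 0 < y / 2 := by positivity
    have n1 := gR_neg ν y
    have n2 := gR_neg (ν + 1) y
    rw [show (ν + 1) * π = ν * π + π by ring, Real.cos_add_pi, Real.sin_add_pi,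
      show -(ν + 1) = -ν - 1 by ring] at n2
    rw [← gR_eq_J _ hy, ← gR_eq_J _ hy, ← gR_eq_J _ hy, ← gR_eq_J _ hy, n1, n2,
      show -(-ν - 1) = ν + 1 by ring, neg_neg, show -(ν + 1) = -ν - 1 by ring,
      Real.rpow_add_one hy2.ne', Real.rpow_sub_one hy2.ne', Real.rpow_neg hy2.le]
    have hpow : (y / 2) ^ ν ≠ 0 := by positivity
    field_simp
    ring
  have hc : Continuous fun ν => x * (gR (ν + 1) x * gI ν x - gR ν x * gI (ν + 1) x) := by
    have c1 : Continuous fun ν => gR ν x := Complex.continuous_re.comp (continuous_hk_order hx)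
    have c2 : Continuous fun ν => gI ν x := Complex.continuous_im.comp (continuous_hk_order hx)
    have c3 : Continuous fun ν => gR (ν + 1) x := c1.comp (continuous_id.add continuous_const)
    have c4 : Continuous fun ν => gI (ν + 1) x := c2.comp (continuous_id.add continuous_const)
    fun_prop
  exact congrFun (Continuous.ext_on nonint_dense hc continuous_const hgen) ν

/-! ### behaviour near zero -/

lemma sB_zero_atTop : Tendsto (sB 0) (𝓝[>] 0) atTop := by
  rw [tendsto_atTop]
  intro b
  set T : ℝ := 2 * |b| + 1 with hT
  have hT0 : 0 < T := by positivity
  have hc : Tendsto (fun x : ℝ => Real.exp (-(x * Real.sinh T))) (𝓝[>] 0) (𝓝 1) := by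
    have : Continuous fun x : ℝ => Real.exp (-(x * Real.sinh T)) := by fun_prop
    have h := this.tendsto 0
    simp only [zero_mul, neg_zero, Real.exp_zero] at h
    exact h.mono_left nhdsWithin_le_nhds
  filter_upwards [hc.eventually (lt_mem_nhds (show (1/2:ℝ) < 1 by norm_num)), self_mem_nhdsWithin]
    with x hx hx0
  have hx0 : 0 < x := hx0
  have h1 : ∫ t in Ioc 0 T, Real.exp (0 * t - x * Real.sinh t) ≤ sB 0 x := by
    refine MeasureTheory.setIntegral_mono_set (sB_integrable 0 hx0)
      (Eventually.of_forall fun t => (Real.exp_pos _).le) ?_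
    exact (Ioc_subset_Ioi_self).eventuallyLE
  have h2 : ∫ t in Ioc 0 T, (1/2 : ℝ) ≤ ∫ t in Ioc 0 T, Real.exp (0 * t - x * Real.sinh t) := by
    refine MeasureTheory.setIntegral_mono_on (by simp) ((sB_integrable 0 hx0).mono_set Ioc_subset_Ioi_self)
      measurableSet_Ioc ?_
    intro t ht
    refine hx.le.trans (Real.exp_le_exp.2 ?_)
    have : Real.sinh t ≤ Real.sinh T := Real.sinh_le_sinh.2 ht.2
    nlinarith
  have h3 : ∫ t in Ioc 0 T, (1/2 : ℝ) = T / 2 := by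
    simp [hT0.le]; ring
  have := le_abs_self b
  linarith

lemma gI_atBot {ν : ℝ} (hν : 0 ≤ ν) : Tendsto (gI ν) (𝓝[>] 0) atBot := by
  have h1 : ∀ᶠ x in 𝓝[>] (0:ℝ), gI ν x ≤ 1 / π * (π + (if ν = 0 then 0 else 1 / ν)) - 1 / π * sB 0 x := by
    filter_upwards [self_mem_nhdsWithin] with x hx
    have hx : 0 < x := hx
    rw [gI_formula, ← mul_sub]
    have hA : (sA ν x).im ≤ π := (le_abs_self _).trans ((Complex.abs_im_le_norm _).trans (norm_sA_le _ _))
    have hp : 0 < 1 / π := by positivity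
    refine mul_le_mul_of_nonneg_left ?_ hp.le
    have hB : sB 0 x ≤ sB ν x := by
      refine MeasureTheory.setIntegral_mono_on (sB_integrable 0 hx) (sB_integrable ν hx)
        measurableSet_Ioi ?_
      intro t ht
      have ht : 0 < t := ht
      refine Real.exp_le_exp.2 ?_
      nlinarith
    split_ifs with h
    · subst h
      have := sB_nonneg 0 x
      simp
      linarith
    · have h0 : 0 < ν := lt_of_le_of_ne hν (Ne.symm h)
      have hb := sB_neg_le h0 hx
      have hc := Real.neg_one_le_cos (ν * π)
      have := sB_nonneg (-ν) x
      nlinarith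
  refine tendsto_atBot_mono' _ h1 ?_
  have hp : 0 < 1 / π := by positivity
  have h2 := (sB_zero_atTop.const_mul_atTop hp)
  have h3 := tendsto_neg_atTop_atBot.comp h2
  have := tendsto_atBot_add_const_left (𝓝[>] 0) (1 / π * (π + (if ν = 0 then 0 else 1 / ν))) h3
  refine this.congr ?_
  intro x; simp; ring

lemma gR_bdd_near {ν : ℝ} (hν : 0 ≤ ν) : ∃ C, ∀ x, 0 < x → |gR ν x| ≤ C := by
  rcases hν.eq_or_lt with h | h
  · subst h
    refine ⟨1, fun x hx => ?_⟩
    rw [gR_formula]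
    simp only [zero_mul, Real.sin_zero, sub_zero]
    rw [abs_mul, abs_of_pos (show 0 < 1 / π by positivity)]
    have h1 : |(sA 0 x).re| ≤ π := (Complex.abs_re_le_norm _).trans (norm_sA_le _ _)
    have hp := Real.pi_pos
    rw [one_div, inv_mul_le_iff₀ hp]; linarith
  · exact ⟨_, fun x hx => gR_bounded h hx⟩

/-! ### asymptotics at infinity -/

lemma sB_le (ν : ℝ) {x : ℝ} (hx : 2 ≤ x) : sB ν x ≤ 2 * Real.exp (ν ^ 2) / x := by
  have hx0 : 0 < x := by linarith
  have hneg : -(x / 2) < 0 := by linarith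
  have h1 : sB ν x ≤ ∫ t in Ioi (0:ℝ), Real.exp (ν ^ 2) * Real.exp (-(x / 2) * t) := by
    refine MeasureTheory.setIntegral_mono_on (sB_integrable _ hx0)
      ((integrableOn_exp_mul_Ioi hneg 0).const_mul _) measurableSet_Ioi ?_
    intro t ht
    have ht : 0 < t := ht
    rw [← Real.exp_add]
    refine Real.exp_le_exp.2 ?_
    have a1 := sq_le_sinh ht.le
    have a2 : t ≤ Real.sinh t := Real.self_le_sinh_iff.2 ht.le
    nlinarith [sq_nonneg (ν - t / 2)]
  rw [MeasureTheory.integral_const_mul, integral_exp_mul_Ioi hneg] at h1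
  refine h1.trans (le_of_eq ?_)
  simp
  field_simp

/-- the smooth factor in the stationary phase estimate -/
noncomputable def stat (ν φ : ℝ) : ℂ :=
  (1 + Complex.I * ((Real.cos φ / (1 + Real.sin φ) : ℝ) : ℂ)) * Complex.exp (-(Complex.I * ((ν * φ : ℝ) : ℂ)))

noncomputable def statD (ν φ : ℝ) : ℂ :=
  (Complex.I * ((-(1 + Real.sin φ)⁻¹ : ℝ) : ℂ)) * Complex.exp (-(Complex.I * ((ν * φ : ℝ) : ℂ)))
   + (1 + Complex.I * ((Real.cos φ / (1 + Real.sin φ) : ℝ) : ℂ)) *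
    (Complex.exp (-(Complex.I * ((ν * φ : ℝ) : ℂ))) * (-(Complex.I * (ν : ℂ))))

lemma one_add_sin_pos {φ : ℝ} (h : φ ∈ uIcc (0:ℝ) π) : 0 < 1 + Real.sin φ := by
  rw [uIcc_of_le Real.pi_pos.le] at h
  have := Real.sin_nonneg_of_nonneg_of_le_pi h.1 h.2
  linarith

lemma hasDerivAt_stat (ν : ℝ) {φ : ℝ} (h : φ ∈ uIcc (0:ℝ) π) :
    HasDerivAt (stat ν) (statD ν φ) φ := by
  have hp := one_add_sin_pos h
  have d1 : HasDerivAt (fun φ => Real.cos φ / (1 + Real.sin φ)) (-(1 + Real.sin φ)⁻¹) φ := by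
    refine ((Real.hasDerivAt_cos φ).div ((Real.hasDerivAt_sin φ).const_add 1) hp.ne').congr_deriv ?_
    field_simp
    nlinarith [Real.sin_sq_add_cos_sq φ]
  have d2 := (d1.ofReal_comp.const_mul Complex.I).const_add 1
  have d3 : HasDerivAt (fun φ : ℝ => ν * φ) ν φ := by
    simpa using (hasDerivAt_id' φ).const_mul ν
  have d4 := (d3.ofReal_comp.const_mul Complex.I).neg.cexp
  exact d2.mul d4

lemma continuousOn_statD (ν : ℝ) : ContinuousOn (statD ν) (uIcc (0:ℝ) π) := by
  unfold statD
  have c1 : ContinuousOn (fun φ : ℝ => -(1 + Real.sin φ)⁻¹) (uIcc (0:ℝ) π) :=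
    (ContinuousOn.inv₀ (by fun_prop) (fun φ h => (one_add_sin_pos h).ne')).neg
  have c2 : ContinuousOn (fun φ : ℝ => Real.cos φ / (1 + Real.sin φ)) (uIcc (0:ℝ) π) :=
    ContinuousOn.div (by fun_prop) (by fun_prop) (fun φ h => (one_add_sin_pos h).ne')
  have c3 := Complex.continuous_ofReal.comp_continuousOn c1
  have c4 := Complex.continuous_ofReal.comp_continuousOn c2
  simp only [Function.comp_def] at c3 c4
  fun_prop

lemma sA_stat (ν x φ : ℝ) (h : φ ∈ uIcc (0:ℝ) π) :
    Complex.exp (Complex.I * ((x * Real.sin φ - (ν + 1) * φ : ℝ) : ℂ))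
    + Complex.I * Complex.exp (Complex.I * ((x * Real.sin φ - ν * φ : ℝ) : ℂ))
    = Complex.exp (Complex.I * ((x * Real.sin φ : ℝ) : ℂ)) * (Real.cos φ : ℂ) * stat ν φ := by
  have hp := one_add_sin_pos h
  have e1 : Complex.exp (Complex.I * ((x * Real.sin φ - ν * φ : ℝ) : ℂ)) =
    Complex.exp (Complex.I * ((x * Real.sin φ : ℝ) : ℂ)) * Complex.exp (-(Complex.I * ((ν * φ : ℝ) : ℂ))) := by
    rw [← Complex.exp_add]; congr 1; push_cast; ring
  rw [cexp_shift_add, e1]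
  unfold stat
  have e2 : Complex.exp (-(φ:ℂ) * Complex.I) + Complex.I =
      (Real.cos φ : ℂ) * (1 + Complex.I * ((Real.cos φ / (1 + Real.sin φ) : ℝ) : ℂ)) := by
    rw [Complex.exp_mul_I, Complex.cos_neg, Complex.sin_neg, ← Complex.ofReal_cos, ← Complex.ofReal_sin]
    have e3 : Real.cos φ * (Real.cos φ / (1 + Real.sin φ)) = 1 - Real.sin φ := by
      field_simp
      nlinarith [Real.sin_sq_add_cos_sq φ]
    have e4 : (Real.cos φ : ℂ) * ((Real.cos φ / (1 + Real.sin φ) : ℝ) : ℂ) = 1 - (Real.sin φ : ℂ) := by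
      exact_mod_cast e3
    linear_combination (-Complex.I) * e4
  linear_combination (Complex.exp (Complex.I * ((x * Real.sin φ : ℝ) : ℂ)) * Complex.exp (-(Complex.I * ((ν * φ : ℝ) : ℂ)))) * e2

lemma sA_asym (ν : ℝ) : ∃ C, ∀ x, 0 < x → ‖sA (ν + 1) x + Complex.I * sA ν x‖ ≤ C / x := by
  refine ⟨‖stat ν π‖ + ‖stat ν 0‖ + |∫ φ in (0:ℝ)..π, ‖statD ν φ‖|, fun x hx => ?_⟩
  have e1 : sA (ν + 1) x + Complex.I * sA ν x = ∫ φ in (0:ℝ)..π,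
      Complex.exp (Complex.I * ((x * Real.sin φ : ℝ) : ℂ)) * (Real.cos φ : ℂ) * stat ν φ := by
    unfold sA
    rw [← intervalIntegral.integral_const_mul, ← intervalIntegral.integral_add (sA_integrable _ _ _ _)
      ((sA_integrable _ _ _ _).const_mul _)]
    refine intervalIntegral.integral_congr ?_
    intro φ hφ
    exact sA_stat ν x φ hφ
  have cS : ContinuousOn (stat ν) (uIcc (0:ℝ) π) := fun φ h =>
    (hasDerivAt_stat ν h).continuousAt.continuousWithinAt
  have hd : ∀ φ ∈ uIcc (0:ℝ) π, HasDerivAt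
      (fun φ : ℝ => Complex.exp (Complex.I * ((x * Real.sin φ : ℝ) : ℂ)) * stat ν φ)
      (Complex.I * x * (Complex.exp (Complex.I * ((x * Real.sin φ : ℝ) : ℂ)) * (Real.cos φ : ℂ) * stat ν φ)
       + Complex.exp (Complex.I * ((x * Real.sin φ : ℝ) : ℂ)) * statD ν φ) φ := by
    intro φ h
    have h1 := (Real.hasDerivAt_sin φ).const_mul x
    have h2 := (h1.ofReal_comp.const_mul Complex.I).cexp
    refine (h2.mul (hasDerivAt_stat ν h)).congr_deriv ?_
    push_cast
    ring
  have i1 : IntervalIntegrable (fun φ : ℝ => Complex.I * x * (Complex.exp (Complex.I * ((x * Real.sin φ : ℝ) : ℂ)) * (Real.cos φ : ℂ) * stat ν φ)) MeasureTheory.volume 0 π := by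
    refine ContinuousOn.intervalIntegrable ?_
    refine ContinuousOn.mul continuousOn_const (ContinuousOn.mul (Continuous.continuousOn (by fun_prop)) cS)
  have i2 : IntervalIntegrable (fun φ : ℝ => Complex.exp (Complex.I * ((x * Real.sin φ : ℝ) : ℂ)) * statD ν φ) MeasureTheory.volume 0 π := by
    refine ContinuousOn.intervalIntegrable ?_
    exact ContinuousOn.mul (Continuous.continuousOn (by fun_prop)) (continuousOn_statD ν)
  have h := intervalIntegral.integral_eq_sub_of_hasDerivAt hd (i1.add i2)
  rw [intervalIntegral.integral_add i1 i2, intervalIntegral.integral_const_mul, ← e1] at h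
  have h' : Complex.I * x * (sA (ν + 1) x + Complex.I * sA ν x) =
     stat ν π - stat ν 0 - ∫ φ in (0:ℝ)..π, Complex.exp (Complex.I * ((x * Real.sin φ : ℝ) : ℂ)) * statD ν φ := by
    simp only [Real.sin_pi, Real.sin_zero, mul_zero, Complex.ofReal_zero, Complex.exp_zero, one_mul] at h
    linear_combination h
  have hn : ‖∫ φ in (0:ℝ)..π, Complex.exp (Complex.I * ((x * Real.sin φ : ℝ) : ℂ)) * statD ν φ‖ ≤
     |∫ φ in (0:ℝ)..π, ‖statD ν φ‖| := by
    refine (intervalIntegral.norm_integral_le_abs_integral_norm).trans (le_of_eq ?_)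
    congr 2
    funext φ
    rw [norm_mul, norm_cexp_I, one_mul]
  have hN := congrArg norm h'
  rw [norm_mul, norm_mul, Complex.norm_I, one_mul, Complex.norm_real, Real.norm_eq_abs, abs_of_pos hx] at hN
  rw [le_div_iff₀ hx, mul_comm, hN]
  refine (norm_sub_le _ _).trans ?_
  gcongr
  exact norm_sub_le _ _

lemma hk_asym (ν : ℝ) : ∃ C, ∀ x, 2 ≤ x → ‖hk (ν + 1) x + Complex.I * hk ν x‖ ≤ C / x := by
  obtain ⟨C, hC⟩ := sA_asym ν
  refine ⟨1 / π * (C + (2 * Real.exp ((ν + 1) ^ 2) + 2 * Real.exp (ν ^ 2) + (2 * Real.exp ((-ν - 1) ^ 2) + 2 * Real.exp ((-ν) ^ 2)))), fun x hx => ?_⟩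
  have hx0 : 0 < x := by linarith
  set e := Complex.exp (-(Complex.I * ((ν * π : ℝ) : ℂ))) with he
  have hen : ‖e‖ = 1 := by
    rw [he, ← mul_neg, ← Complex.ofReal_neg]; exact norm_cexp_I _
  have e1 : hk (ν + 1) x + Complex.I * hk ν x = ((1 / π : ℝ) : ℂ) * ((sA (ν + 1) x + Complex.I * sA ν x)
      - Complex.I * (((sB (ν + 1) x : ℂ) + Complex.I * sB ν x) + e * (-(sB (-ν - 1) x : ℂ) + Complex.I * sB (-ν) x))) := by
    unfold hk
    rw [cexp_phase_add, show -(ν + 1) = -ν - 1 by ring, ← he]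
    push_cast
    ring
  rw [e1, norm_mul, Complex.norm_real, Real.norm_eq_abs, abs_of_pos (show 0 < 1 / π by positivity), mul_div_assoc]
  refine mul_le_mul_of_nonneg_left ?_ (by positivity)
  have nB : ∀ μ, ‖(sB μ x : ℂ)‖ ≤ 2 * Real.exp (μ ^ 2) / x := by
    intro μ
    rw [Complex.norm_real, Real.norm_eq_abs, abs_of_nonneg (sB_nonneg _ _)]
    exact sB_le μ hx
  have nIB : ∀ μ, ‖Complex.I * (sB μ x : ℂ)‖ ≤ 2 * Real.exp (μ ^ 2) / x := by
    intro μ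
    rw [norm_mul, Complex.norm_I, one_mul]; exact nB μ
  have n1 : ‖(sB (ν + 1) x : ℂ) + Complex.I * sB ν x‖ ≤ _ :=
    (norm_add_le _ _).trans (add_le_add (nB _) (nIB _))
  have n2 : ‖e * (-(sB (-ν - 1) x : ℂ) + Complex.I * sB (-ν) x)‖ ≤ 2 * Real.exp ((-ν - 1) ^ 2) / x + 2 * Real.exp ((-ν) ^ 2) / x := by
    rw [norm_mul, hen, one_mul]
    refine (norm_add_le _ _).trans (add_le_add ?_ (nIB _))
    rw [norm_neg]; exact nB _
  have n3 := norm_add_le ((sB (ν + 1) x : ℂ) + Complex.I * sB ν x) (e * (-(sB (-ν - 1) x : ℂ) + Complex.I * sB (-ν) x))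
  refine (norm_sub_le _ _).trans ?_
  rw [norm_mul, Complex.norm_I, one_mul]
  have n0 := hC x hx0
  have : ∀ a b c d f : ℝ, (a + (b + c + (d + f))) / x = a / x + (b / x + c / x + (d / x + f / x)) := by
    intros; ring
  rw [this]
  linarith

/-! ### the modulus system -/

noncomputable def dR (ν x : ℝ) : ℝ := ν * gR ν x - x * gR (ν + 1) x
noncomputable def dI (ν x : ℝ) : ℝ := ν * gI ν x - x * gI (ν + 1) x
noncomputable def mp (ν x : ℝ) : ℝ := gR ν x ^ 2 + gI ν x ^ 2
noncomputable def mr (ν x : ℝ) : ℝ := 2 * (gR ν x * dR ν x + gI ν x * dI ν x)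
noncomputable def ms (ν x : ℝ) : ℝ := dR ν x ^ 2 + dI ν x ^ 2

lemma asym_small (ν : ℝ) :
    Tendsto (fun x => √x * (gR (ν + 1) x - gI ν x)) atTop (𝓝 0) ∧
    Tendsto (fun x => √x * (gI (ν + 1) x + gR ν x)) atTop (𝓝 0) := by
  obtain ⟨C, hC⟩ := hk_asym ν
  have ht : Tendsto (fun x : ℝ => C / √x) atTop (𝓝 0) :=
    tendsto_const_nhds.div_atTop Real.tendsto_sqrt_atTop
  have key : ∀ x : ℝ, 2 ≤ x → ∀ z : ℝ, |z| ≤ ‖hk (ν + 1) x + Complex.I * hk ν x‖ → ‖√x * z‖ ≤ C / √x := by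
    intro x hx z hz
    have hx0 : 0 < x := by linarith
    have hs : 0 < √x := Real.sqrt_pos.2 hx0
    rw [norm_mul, Real.norm_eq_abs, Real.norm_eq_abs, abs_of_pos hs, le_div_iff₀ hs]
    have h1 := hz.trans (hC x hx)
    rw [le_div_iff₀ hx0] at h1
    have h2 := Real.mul_self_sqrt hx0.le
    calc √x * |z| * √x = |z| * (√x * √x) := by ring
      _ ≤ C := by rw [h2]; exact h1
  constructor
  · refine squeeze_zero_norm' ?_ ht
    filter_upwards [eventually_ge_atTop 2] with x hx
    refine key x hx _ ?_
    refine le_trans (le_of_eq ?_) (Complex.abs_re_le_norm _)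
    simp [gR, gI, sub_eq_add_neg]
  · refine squeeze_zero_norm' ?_ ht
    filter_upwards [eventually_ge_atTop 2] with x hx
    refine key x hx _ ?_
    refine le_trans (le_of_eq ?_) (Complex.abs_im_le_norm _)
    simp [gR, gI]

lemma asym (ν : ℝ) : Tendsto (fun x => x * mp ν x) atTop (𝓝 (2 / π)) ∧
    Tendsto (mr ν) atTop (𝓝 0) ∧ Tendsto (fun x => ms ν x / x) atTop (𝓝 (2 / π)) := by
  obtain ⟨t1, t2⟩ := asym_small ν
  set e1 := fun x => √x * (gR (ν + 1) x - gI ν x) with he1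
  set e2 := fun x => √x * (gI (ν + 1) x + gR ν x) with he2
  set X := fun x => √x * gR ν x with hX
  set Y := fun x => √x * gI ν x with hY
  have sq : ∀ x : ℝ, 0 < x → √x * √x = x := fun x hx => Real.mul_self_sqrt hx.le
  have hW : ∀ x, 0 < x → X x ^ 2 + Y x ^ 2 = 2 / π - e1 x * Y x + e2 x * X x := by
    intro x hx
    rw [← wron ν hx]
    simp only [he1, he2, hX, hY]
    linear_combination (gI ν x * gR (ν + 1) x - gI (ν + 1) x * gR ν x) * sq x hx
  have hbd : ∀ᶠ x in atTop, X x ^ 2 + Y x ^ 2 ≤ 4 / π + 2 := by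
    filter_upwards [eventually_gt_atTop 0, t1.eventually (Ioo_mem_nhds (show (-1:ℝ) < 0 by norm_num) (show (0:ℝ) < 1 by norm_num)), t2.eventually (Ioo_mem_nhds (show (-1:ℝ) < 0 by norm_num) (show (0:ℝ) < 1 by norm_num))] with x hx h1 h2
    have := hW x hx
    have q1 : e1 x ^ 2 ≤ 1 := by nlinarith [h1.1, h1.2]
    have q2 : e2 x ^ 2 ≤ 1 := by nlinarith [h2.1, h2.2]
    have : 4 / π = 2 * (2 / π) := by ring
    nlinarith [sq_nonneg (e1 x + Y x), sq_nonneg (e2 x - X x)]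
  have bX : IsBoundedUnder (· ≤ ·) atTop (fun x => ‖X x‖) :=
    isBoundedUnder_of_eventually_le (a := 4 / π + 2 + 1) (by
      filter_upwards [hbd] with x hx
      rw [Real.norm_eq_abs]
      refine abs_le.2 ⟨?_, ?_⟩ <;> nlinarith [sq_nonneg (X x - 1), sq_nonneg (X x + 1), sq_nonneg (Y x)])
  have bY : IsBoundedUnder (· ≤ ·) atTop (fun x => ‖Y x‖) :=
    isBoundedUnder_of_eventually_le (a := 4 / π + 2 + 1) (by
      filter_upwards [hbd] with x hx
      rw [Real.norm_eq_abs]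
      refine abs_le.2 ⟨?_, ?_⟩ <;> nlinarith [sq_nonneg (Y x - 1), sq_nonneg (Y x + 1), sq_nonneg (X x)])
  have A : Tendsto (fun x => X x ^ 2 + Y x ^ 2) atTop (𝓝 (2 / π)) := by
    have := ((t1.zero_mul_isBoundedUnder_le bY).const_sub (2 / π)).add (t2.zero_mul_isBoundedUnder_le bX)
    simp only [sub_zero, add_zero] at this
    refine this.congr' ?_
    filter_upwards [eventually_gt_atTop 0] with x hx
    exact (hW x hx).symm
  have hinv : Tendsto (fun x : ℝ => ν / x) atTop (𝓝 0) := tendsto_const_nhds.div_atTop tendsto_id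
  refine ⟨?_, ?_, ?_⟩
  · refine A.congr' ?_
    filter_upwards [eventually_gt_atTop 0] with x hx
    simp only [hX, hY, mp]
    linear_combination (gR ν x ^ 2 + gI ν x ^ 2) * sq x hx
  · have := (((hinv.mul A).sub ((t1.zero_mul_isBoundedUnder_le bX).add (t2.zero_mul_isBoundedUnder_le bY))).const_mul 2)
    simp only [zero_mul, add_zero, sub_zero, mul_zero] at this
    refine this.congr' ?_
    filter_upwards [eventually_gt_atTop 0] with x hx
    simp only [hX, hY, he1, he2, mr, dR, dI]
    field_simp
    rw [Real.sq_sqrt hx.le]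
    ring
  · have ta := (hinv.zero_mul_isBoundedUnder_le bX).sub t1
    have tb := (hinv.zero_mul_isBoundedUnder_le bY).sub t2
    simp only [sub_zero] at ta tb
    have := A.add ((((ta.pow 2).add (tb.pow 2)).sub ((ta.zero_mul_isBoundedUnder_le bY).const_mul 2)).add ((tb.zero_mul_isBoundedUnder_le bX).const_mul 2))
    simp only [ne_eq, OfNat.ofNat_ne_zero, not_false_eq_true, zero_pow, mul_zero, add_zero, sub_zero] at this
    refine this.congr' ?_
    filter_upwards [eventually_gt_atTop 0] with x hx
    simp only [hX, hY, he1, he2, ms, dR, dI]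
    have h4 := sq x hx
    field_simp
    have h5 : √x ^ 2 = x := Real.sq_sqrt hx.le
    rw [h5]
    ring

lemma hasDerivAt_gR_d (ν : ℝ) {x : ℝ} (hx : 0 < x) : HasDerivAt (gR ν) (dR ν x / x) x := by
  refine (hasDerivAt_gR ν hx).congr_deriv ?_
  unfold dR; field_simp

lemma hasDerivAt_gI_d (ν : ℝ) {x : ℝ} (hx : 0 < x) : HasDerivAt (gI ν) (dI ν x / x) x := by
  refine (hasDerivAt_gI ν hx).congr_deriv ?_
  unfold dI; field_simp

lemma hasDerivAt_dR (ν : ℝ) {x : ℝ} (hx : 0 < x) :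
    HasDerivAt (dR ν) ((ν ^ 2 - x ^ 2) * gR ν x / x) x := by
  refine (((hasDerivAt_gR ν hx).const_mul ν).sub ((hasDerivAt_id' x).mul (hasDerivAt_gR_up ν hx))).congr_deriv ?_
  field_simp; ring

lemma hasDerivAt_dI (ν : ℝ) {x : ℝ} (hx : 0 < x) :
    HasDerivAt (dI ν) ((ν ^ 2 - x ^ 2) * gI ν x / x) x := by
  refine (((hasDerivAt_gI ν hx).const_mul ν).sub ((hasDerivAt_id' x).mul (hasDerivAt_gI_up ν hx))).congr_deriv ?_
  field_simp; ring

lemma hasDerivAt_mp (ν : ℝ) {x : ℝ} (hx : 0 < x) : HasDerivAt (mp ν) (mr ν x / x) x := by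
  refine (((hasDerivAt_gR_d ν hx).pow 2).add ((hasDerivAt_gI_d ν hx).pow 2)).congr_deriv ?_
  unfold mr; norm_num; ring

lemma hasDerivAt_ms (ν : ℝ) {x : ℝ} (hx : 0 < x) :
    HasDerivAt (ms ν) ((ν ^ 2 - x ^ 2) * mr ν x / x) x := by
  refine (((hasDerivAt_dR ν hx).pow 2).add ((hasDerivAt_dI ν hx).pow 2)).congr_deriv ?_
  unfold mr; norm_num; ring

lemma hasDerivAt_mr (ν : ℝ) {x : ℝ} (hx : 0 < x) :
    HasDerivAt (mr ν) ((2 * ms ν x + 2 * (ν ^ 2 - x ^ 2) * mp ν x) / x) x := by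
  refine ((((hasDerivAt_gR_d ν hx).mul (hasDerivAt_dR ν hx)).add
    ((hasDerivAt_gI_d ν hx).mul (hasDerivAt_dI ν hx))).const_mul 2).congr_deriv ?_
  unfold ms mp; ring

lemma wron_d (ν : ℝ) {x : ℝ} (hx : 0 < x) : gR ν x * dI ν x - gI ν x * dR ν x = 2 / π := by
  rw [← wron ν hx]; unfold dR dI; ring

lemma mono_le_lim_atTop {f : ℝ → ℝ} (h : MonotoneOn f (Ioi 0)) {c : ℝ}
    (hl : Tendsto f atTop (𝓝 c)) {x : ℝ} (hx : 0 < x) : f x ≤ c := by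
  refine ge_of_tendsto hl ?_
  filter_upwards [eventually_ge_atTop x] with y hy
  exact h hx (show (0:ℝ) < y by linarith) hy

lemma anti_ge_lim_atTop {f : ℝ → ℝ} (h : AntitoneOn f (Ioi 0)) {c : ℝ}
    (hl : Tendsto f atTop (𝓝 c)) {x : ℝ} (hx : 0 < x) : c ≤ f x := by
  refine le_of_tendsto hl ?_
  filter_upwards [eventually_ge_atTop x] with y hy
  exact h hx (show (0:ℝ) < y by linarith) hy

lemma mp_compare {ν μ : ℝ} (hdec : ∀ x, 0 < x → mr ν x ≤ 0) {x₀ : ℝ} (hx₀ : 0 < x₀) :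
    (ν ^ 2 ≤ μ ^ 2 → mp ν x₀ ≤ mp μ x₀) ∧ (μ ^ 2 ≤ ν ^ 2 → mp μ x₀ ≤ mp ν x₀) := by
  set α := gR μ x₀ with hα
  set β := gI μ x₀ with hβ
  set y : ℝ → ℝ := fun x => α * gI μ x - β * gR μ x with hy
  set z : ℝ → ℝ := fun x => α * dI μ x - β * dR μ x with hz
  set k := μ ^ 2 - ν ^ 2 with hk
  have dy : ∀ x, 0 < x → HasDerivAt y (z x / x) x := by
    intro x hx
    refine (((hasDerivAt_gI_d μ hx).const_mul α).sub ((hasDerivAt_gR_d μ hx).const_mul β)).congr_deriv ?_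
    simp only [hz]; ring
  have dz : ∀ x, 0 < x → HasDerivAt z ((μ ^ 2 - x ^ 2) * y x / x) x := by
    intro x hx
    refine (((hasDerivAt_dI μ hx).const_mul α).sub ((hasDerivAt_dR μ hx).const_mul β)).congr_deriv ?_
    simp only [hy]; ring
  set Ψ : ℝ → ℝ := fun x => (mp μ x - mp ν x) * z x ^ 2 + (ms μ x - ms ν x) * y x ^ 2
    - (mr μ x - mr ν x) * (y x * z x) + k * (mp ν x * y x ^ 2) with hΨ
  have dΨ : ∀ x, 0 < x → HasDerivAt Ψ (2 * k * mr ν x * y x ^ 2 / x) x := by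
    intro x hx
    refine ((((((hasDerivAt_mp μ hx).sub (hasDerivAt_mp ν hx)).mul ((dz x hx).pow 2)).add
      (((hasDerivAt_ms μ hx).sub (hasDerivAt_ms ν hx)).mul ((dy x hx).pow 2))).sub
      (((hasDerivAt_mr μ hx).sub (hasDerivAt_mr ν hx)).mul ((dy x hx).mul (dz x hx)))).add
      (((hasDerivAt_mp ν hx).mul ((dy x hx).pow 2)).const_mul k)).congr_deriv ?_
    simp only [Pi.mul_apply, Pi.sub_apply, Pi.pow_apply]
    rw [hk]
    norm_num
    field_simp
    ring
  obtain ⟨p1, r1, s1⟩ := asym ν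
  obtain ⟨p2, r2, s2⟩ := asym μ
  set K := α ^ 2 + β ^ 2 with hK
  have hK0 : 0 ≤ K := by positivity
  have bP : ∀ x, y x ^ 2 ≤ K * mp μ x := by
    intro x; simp only [hy, hK, mp]; nlinarith [sq_nonneg (α * gR μ x + β * gI μ x)]
  have bS : ∀ x, z x ^ 2 ≤ K * ms μ x := by
    intro x; simp only [hz, hK, ms]; nlinarith [sq_nonneg (α * dR μ x + β * dI μ x)]
  have hlim : Tendsto Ψ atTop (𝓝 0) := by
    have pd : Tendsto (fun x => |x * mp μ x - x * mp ν x|) atTop (𝓝 0) := by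
      simpa using (p2.sub p1).abs
    have sd : Tendsto (fun x => |ms μ x / x - ms ν x / x|) atTop (𝓝 0) := by
      simpa using (s2.sub s1).abs
    have rd : Tendsto (fun x => |mr μ x - mr ν x|) atTop (𝓝 0) := by
      simpa using (r2.sub r1).abs
    have iv : Tendsto (fun x : ℝ => (x⁻¹) ^ 2) atTop (𝓝 0) := by
      simpa using (tendsto_inv_atTop_zero (𝕜 := ℝ)).pow 2
    have T := (((pd.mul (s2.const_mul K)).add (sd.mul (p2.const_mul K))).add
      (rd.mul ((p2.add s2).const_mul K))).add ((iv.mul (p1.mul p2)).const_mul (|k| * K))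
    simp only [zero_mul, add_zero, mul_zero] at T
    refine squeeze_zero_norm' ?_ T
    filter_upwards [eventually_gt_atTop 0] with x hx
    have a1 : |(mp μ x - mp ν x) * z x ^ 2| ≤ |x * mp μ x - x * mp ν x| * (K * (ms μ x / x)) := by
      rw [← mul_sub, abs_mul, abs_mul, abs_of_pos hx, abs_of_nonneg (sq_nonneg (z x))]
      calc |mp μ x - mp ν x| * z x ^ 2 ≤ |mp μ x - mp ν x| * (K * ms μ x) := by
            gcongr; exact bS x
        _ = _ := by field_simp
    have a2 : |(ms μ x - ms ν x) * y x ^ 2| ≤ |ms μ x / x - ms ν x / x| * (K * (x * mp μ x)) := by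
      rw [← sub_div, abs_mul, abs_div, abs_of_pos hx, abs_of_nonneg (sq_nonneg (y x))]
      calc |ms μ x - ms ν x| * y x ^ 2 ≤ |ms μ x - ms ν x| * (K * mp μ x) := by
            gcongr; exact bP x
        _ = _ := by field_simp
    have a3 : |(mr μ x - mr ν x) * (y x * z x)| ≤ |mr μ x - mr ν x| * (K * (x * mp μ x + ms μ x / x)) := by
      rw [abs_mul]
      gcongr
      have h1 : x * y x ^ 2 ≤ x * (K * mp μ x) := by gcongr; exact bP x
      have h2 : z x ^ 2 / x ≤ (K * ms μ x) / x := by gcongr; exact bS x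
      have h3 : |y x * z x| ≤ x * y x ^ 2 + z x ^ 2 / x := by
        have e1 : x * y x ^ 2 + z x ^ 2 / x = (x ^ 2 * y x ^ 2 + z x ^ 2) / x := by field_simp
        rw [e1, le_div_iff₀ hx]
        have e2 : |y x * z x| * x = |x * y x| * |z x| := by
          rw [abs_mul, abs_mul, abs_of_pos hx]; ring
        rw [e2]
        nlinarith [sq_nonneg (|x * y x| - |z x|), sq_abs (x * y x), sq_abs (z x), sq_nonneg (x * y x), sq_nonneg (z x)]
      have e3 : K * (x * mp μ x + ms μ x / x) = x * (K * mp μ x) + K * ms μ x / x := by ring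
      rw [e3]; linarith
    have a4 : |k * (mp ν x * y x ^ 2)| ≤ |k| * K * ((x⁻¹) ^ 2 * ((x * mp ν x) * (x * mp μ x))) := by
      have hm : 0 ≤ mp ν x := by unfold mp; positivity
      rw [abs_mul, abs_mul, abs_of_nonneg hm, abs_of_nonneg (sq_nonneg (y x))]
      calc |k| * (mp ν x * y x ^ 2) ≤ |k| * (mp ν x * (K * mp μ x)) := by
            gcongr; exact bP x
        _ = _ := by field_simp
    rw [Real.norm_eq_abs]
    simp only [hΨ]
    refine (abs_add_le _ _).trans (add_le_add ?_ a4)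
    refine (abs_sub _ _).trans (add_le_add ?_ a3)
    exact (abs_add_le _ _).trans (add_le_add a1 a2)
  have hy0 : y x₀ = 0 := by simp only [hy, hα, hβ]; ring
  have hz0 : z x₀ = 2 / π := by simp only [hz, hα, hβ]; exact wron_d μ hx₀
  have hΨ0 : Ψ x₀ = (mp μ x₀ - mp ν x₀) * (2 / π) ^ 2 := by
    simp only [hΨ, hy0, hz0]; ring
  have hpi : 0 < (2 / π) ^ 2 := by positivity
  constructor
  · intro hle
    have hk0 : 0 ≤ k := by rw [hk]; linarith
    have hm : AntitoneOn Ψ (Ioi 0) := anti_Ioi dΨ (fun x hx => by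
      have := mul_nonneg hk0 (sq_nonneg (y x))
      have h2 := hdec x hx
      refine div_nonpos_of_nonpos_of_nonneg ?_ hx.le
      nlinarith)
    have := anti_ge_lim_atTop hm hlim hx₀
    rw [hΨ0] at this
    have := nonneg_of_mul_nonneg_left this hpi
    linarith
  · intro hle
    have hk0 : k ≤ 0 := by rw [hk]; linarith
    have hm : MonotoneOn Ψ (Ioi 0) := mono_Ioi dΨ (fun x hx => by
      have := mul_nonneg (neg_nonneg.2 hk0) (sq_nonneg (y x))
      have h2 := hdec x hx
      refine div_nonneg ?_ hx.le
      nlinarith)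
    have := mono_le_lim_atTop hm hlim hx₀
    rw [hΨ0] at this
    have := nonpos_of_mul_nonpos_left this hpi
    linarith

lemma mp_eq (ν x : ℝ) : mp ν x = ‖hk ν x‖ ^ 2 := by
  rw [Complex.sq_norm, Complex.normSq_apply]; unfold mp gR gI; ring

lemma mp_neg (ν x : ℝ) : mp (-ν) x = mp ν x := by
  rw [mp_eq, mp_eq, hk_neg, norm_mul, norm_cexp_I, one_mul]

lemma mr_diff (ν : ℝ) {x : ℝ} (hx : 0 < x) :
    2 * ν * mr ν x = x ^ 2 * (mp (ν - 1) x - mp (ν + 1) x) := by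
  have h1 := gR_rec ν hx
  have h2 := gI_rec ν hx
  have e1 : gR (ν - 1) x = 2 * ν / x * gR ν x - gR (ν + 1) x := by linarith
  have e2 : gI (ν - 1) x = 2 * ν / x * gI ν x - gI (ν + 1) x := by linarith
  unfold mp mr dR dI
  rw [e1, e2]
  field_simp
  ring

def Dec (ν : ℝ) : Prop := ∀ x, 0 < x → mr ν x ≤ 0

lemma dec_of_le {ν : ℝ} (hν : 0 < ν) (h : ∀ x, 0 < x → mp (ν - 1) x ≤ mp (ν + 1) x) : Dec ν := by
  intro x hx
  have h1 := mr_diff ν hx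
  have h2 := h x hx
  by_contra hc
  have h3 : 0 < 2 * ν * mr ν x := by
    have : 0 < mr ν x := not_le.1 hc
    positivity
  have h4 : x ^ 2 * (mp (ν - 1) x - mp (ν + 1) x) ≤ 0 :=
    mul_nonpos_of_nonneg_of_nonpos (by positivity) (by linarith)
  linarith

lemma dec_half : Dec (1 / 2) := by
  intro x hx
  have h1 := hk_neg (1 / 2) x
  have e : Complex.exp (Complex.I * (((1 / 2 : ℝ) * π : ℝ) : ℂ)) = Complex.I := by
    rw [show Complex.I * (((1 / 2 : ℝ) * π : ℝ) : ℂ) = π / 2 * Complex.I by push_cast; ring]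
    exact Complex.exp_pi_div_two_mul_I
  rw [e] at h1
  have a1 : gR (-(1/2)) x = - gI (1 / 2) x := by unfold gR gI; rw [h1]; simp
  have a2 : gI (-(1/2)) x = gR (1 / 2) x := by unfold gR gI; rw [h1]; simp
  have r1 := gR_rec (1 / 2) hx
  have r2 := gI_rec (1 / 2) hx
  rw [show (1 / 2 - 1 : ℝ) = -(1 / 2) by norm_num] at r1 r2
  rw [a1] at r1
  rw [a2] at r2
  have b1 : x * gR (1 / 2 + 1) x = gR (1/2) x + x * gI (1/2) x := by
    have : gR (1 / 2 + 1) x = 2 * (1 / 2) / x * gR (1 / 2) x + gI (1/2) x := by linarith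
    rw [this]; field_simp
  have b2 : x * gI (1 / 2 + 1) x = gI (1/2) x - x * gR (1/2) x := by
    have : gI (1 / 2 + 1) x = 2 * (1 / 2) / x * gI (1 / 2) x - gR (1/2) x := by linarith
    rw [this]; field_simp
  have : mr (1 / 2) x = -(gR (1/2) x ^ 2 + gI (1/2) x ^ 2) := by
    unfold mr dR dI
    linear_combination (-2 * gR (1/2) x) * b1 + (-2 * gI (1/2) x) * b2
  rw [this]
  have := sq_nonneg (gR (1/2) x)
  have := sq_nonneg (gI (1/2) x)
  linarith

lemma dec_mid {ν : ℝ} (h1 : 1 / 2 ≤ ν) (h2 : ν ≤ 3 / 2) : Dec ν := by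
  refine dec_of_le (by linarith) fun x hx => ?_
  have c := fun μ => mp_compare (μ := μ) dec_half hx
  refine ((c (ν - 1)).2 ?_).trans ((c (ν + 1)).1 ?_)
  · nlinarith
  · nlinarith

lemma dec_big (n : ℕ) : ∀ ν : ℝ, 1 / 2 ≤ ν → ν ≤ 3 / 2 + n → Dec ν := by
  induction n with
  | zero => intro ν h1 h2; exact dec_mid h1 (by simpa using h2)
  | succ n ih =>
    intro ν h1 h2
    push_cast at h2
    by_cases h : ν ≤ 3 / 2
    · exact dec_mid h1 h
    · have hd := ih (ν - 1) (by linarith) (by linarith)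
      refine dec_of_le (by linarith) fun x hx => ?_
      exact (mp_compare hd hx).1 (by nlinarith)

lemma dec_pos {ν : ℝ} (hν : 0 < ν) : Dec ν := by
  by_cases h : 1 / 2 ≤ ν
  · obtain ⟨n, hn⟩ := exists_nat_ge ν
    exact dec_big n ν h (by linarith)
  · have hd := dec_mid (ν := 1 - ν) (by linarith) (by linarith)
    refine dec_of_le hν fun x hx => ?_
    rw [← mp_neg (ν - 1), neg_sub]
    exact (mp_compare hd hx).1 (by nlinarith)

lemma cont_gR_order {x : ℝ} (hx : 0 < x) : Continuous fun ν => gR ν x :=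
  Complex.continuous_re.comp (continuous_hk_order hx)

lemma cont_gI_order {x : ℝ} (hx : 0 < x) : Continuous fun ν => gI ν x :=
  Complex.continuous_im.comp (continuous_hk_order hx)

lemma dec_nonneg {ν : ℝ} (hν : 0 ≤ ν) : Dec ν := by
  rcases hν.eq_or_lt with h | h
  · subst h
    intro x hx
    have c1 := cont_gR_order hx
    have c2 := cont_gI_order hx
    have c3 : Continuous fun ν => gR (ν + 1) x := c1.comp (continuous_id.add continuous_const)
    have c4 : Continuous fun ν => gI (ν + 1) x := c2.comp (continuous_id.add continuous_const)
    have hc : Continuous fun ν => mr ν x := by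
      unfold mr dR dI; fun_prop
    have ht : Tendsto (fun ν => mr ν x) (𝓝[>] 0) (𝓝 (mr 0 x)) :=
      (hc.tendsto 0).mono_left nhdsWithin_le_nhds
    refine le_of_tendsto ht ?_
    filter_upwards [self_mem_nhdsWithin] with ν hν
    exact dec_pos hν x hx
  · exact dec_pos h

lemma mp_mono {ν μ : ℝ} (hν : 0 ≤ ν) (h : ν ≤ μ) {x : ℝ} (hx : 0 < x) : mp ν x ≤ mp μ x :=
  (mp_compare (dec_nonneg hν) hx).1 (by nlinarith)

lemma mp_pos (ν : ℝ) {x : ℝ} (hx : 0 < x) : 0 < mp ν x := by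
  have h := wron ν hx
  have hp : 0 < 2 / π := by positivity
  have h0 : 0 ≤ mp ν x := by unfold mp; positivity
  refine lt_of_le_of_ne h0 fun h1 => ?_
  have a1 : gR ν x = 0 := by unfold mp at h1; nlinarith [sq_nonneg (gR ν x), sq_nonneg (gI ν x)]
  have a2 : gI ν x = 0 := by unfold mp at h1; nlinarith [sq_nonneg (gR ν x), sq_nonneg (gI ν x)]
  rw [a1, a2] at h
  simp at h
  linarith

noncomputable def pw (ν x : ℝ) : ℝ := 2 / (π * x * mp ν x)

lemma cont_pw (ν : ℝ) : ContinuousOn (pw ν) (Ioi 0) := by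
  intro x hx
  have hx' : 0 < x := hx
  have h1 : ContinuousAt (mp ν) x := (hasDerivAt_mp ν hx').continuousAt
  have h2 : π * x * mp ν x ≠ 0 := by
    have := mp_pos ν hx'; positivity
  refine ContinuousAt.continuousWithinAt ?_
  exact continuousAt_const.div ((continuousAt_const.mul continuousAt_id).mul h1) h2

lemma pw_pos (ν : ℝ) {x : ℝ} (hx : 0 < x) : 0 < pw ν x := by
  have := mp_pos ν hx
  unfold pw; positivity

lemma exists_prim (ν : ℝ) : ∃ T : ℝ → ℝ, ∀ x, 0 < x → HasDerivAt T (pw ν x) x := by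
  refine ⟨fun u => ∫ x in (1:ℝ)..u, pw ν x, fun x hx => ?_⟩
  have hc := cont_pw ν
  have hca : ContinuousAt (pw ν) x := hc.continuousAt (Ioi_mem_nhds hx)
  refine intervalIntegral.integral_hasDerivAt_right ?_ ?_ hca
  · refine (hc.mono ?_).intervalIntegrable
    intro y hy
    rw [mem_uIcc] at hy
    show 0 < y
    rcases hy with h | h <;> linarith [h.1]
  · exact hc.stronglyMeasurableAtFilter isOpen_Ioi x hx

lemma exists_phase {ν : ℝ} (hν : 0 ≤ ν) : ∃ th v : ℝ → ℝ,
    (∀ x, 0 < x → HasDerivAt th (pw ν x) x) ∧ Tendsto th (𝓝[>] 0) (𝓝 0) ∧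
    ∀ x, 0 < x → 0 < v x ∧ v x ^ 2 = mp ν x ∧ gR ν x = v x * sin (th x) ∧
      gI ν x = - (v x * cos (th x)) := by
  obtain ⟨T, hT⟩ := exists_prim ν
  have hneg : ∀ᶠ x in 𝓝[>] (0:ℝ), gI ν x < 0 := (gI_atBot hν).eventually (eventually_lt_atBot 0)
  obtain ⟨ε, hε, hε'⟩ := mem_nhdsGT_iff_exists_Ioo_subset.1 hneg
  have hε0 : (0:ℝ) < ε := hε
  set q : ℝ → ℝ := fun x => gR ν x / (- gI ν x) with hq
  have hq0 : Tendsto q (𝓝[>] 0) (𝓝 0) := by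
    obtain ⟨C, hC⟩ := gR_bdd_near hν
    have h1 : Tendsto (fun x => C / (- gI ν x)) (𝓝[>] 0) (𝓝 0) :=
      tendsto_const_nhds.div_atTop (tendsto_neg_atBot_atTop.comp (gI_atBot hν))
    refine squeeze_zero_norm' ?_ h1
    filter_upwards [hneg, self_mem_nhdsWithin] with x hx hx0
    rw [hq, Real.norm_eq_abs, abs_div, abs_of_pos (show 0 < - gI ν x by linarith)]
    exact div_le_div_of_nonneg_right (hC x hx0) (by linarith)
  have hdq : ∀ x ∈ Ioo 0 ε, HasDerivAt (fun x => arctan (q x) - T x) 0 x := by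
    intro x hx
    have hg : gI ν x < 0 := hε' hx
    have h1 := (((hasDerivAt_gR_d ν hx.1).div (hasDerivAt_gI_d ν hx.1).neg
      (show (- gI ν) x ≠ 0 by simpa using hg.ne)).arctan).sub (hT x hx.1)
    refine h1.congr_deriv ?_
    have hw := wron_d ν hx.1
    have hm := mp_pos ν hx.1
    have hg' := hg.ne
    have hx0 := hx.1.ne'
    have : pw ν x = (gR ν x * dI ν x - gI ν x * dR ν x) / (x * mp ν x) := by
      rw [hw]; unfold pw; field_simp
    rw [this]
    have hm' : gR ν x ^ 2 + gI ν x ^ 2 ≠ 0 := hm.ne'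
    have hm'' : gI ν x ^ 2 + gR ν x ^ 2 ≠ 0 := by rw [add_comm]; exact hm'
    simp only [Pi.div_apply, Pi.neg_apply]
    unfold mp
    have e : 1 + (gR ν x / - gI ν x) ^ 2 = (gI ν x ^ 2 + gR ν x ^ 2) / gI ν x ^ 2 := by
      field_simp
    rw [e]
    field_simp
    ring
  set y0 := ε / 2 with hy0
  have hy0m : y0 ∈ Ioo 0 ε := ⟨by positivity, by rw [hy0]; linarith⟩
  set c := arctan (q y0) - T y0 with hc
  have hcon : ∀ x ∈ Ioo 0 ε, arctan (q x) - T x = c := by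
    intro x hx
    exact isOpen_Ioo.is_const_of_deriv_eq_zero isPreconnected_Ioo
      (fun z hz => (hdq z hz).differentiableAt.differentiableWithinAt)
      (fun z hz => (hdq z hz).deriv) hx hy0m
  set th : ℝ → ℝ := fun x => T x + c with hth
  have hthd : ∀ x, 0 < x → HasDerivAt th (pw ν x) x := fun x hx => (hT x hx).add_const c
  have hthq : ∀ x ∈ Ioo 0 ε, th x = arctan (q x) := fun x hx => by
    have := hcon x hx
    simp only [hth]; linarith
  set u : ℝ → ℝ := fun x => gR ν x * cos (th x) + gI ν x * sin (th x) with hu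
  set v : ℝ → ℝ := fun x => gR ν x * sin (th x) - gI ν x * cos (th x) with hv
  have hnear : ∀ x ∈ Ioo 0 ε, u x = 0 ∧ 0 < v x := by
    intro x hx
    have hg : gI ν x < 0 := hε' hx
    have hcp := cos_arctan_pos (q x)
    have ht : sin (arctan (q x)) = q x * cos (arctan (q x)) := by
      rw [← tan_mul_cos hcp.ne', tan_arctan]
    have hqg : q x * gI ν x = - gR ν x := by
      have hg' := hg.ne
      simp only [hq]; field_simp
    simp only [hu, hv, hthq x hx, ht]
    constructor
    · linear_combination cos (arctan (q x)) * hqg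
    · have : gR ν x = - (q x * gI ν x) := by linarith
      rw [this]
      have : 0 < (-gI ν x) * cos (arctan (q x)) * (1 + q x ^ 2) := by
        have : 0 < - gI ν x := by linarith
        positivity
      nlinarith
  have hud : ∀ x, 0 < x → HasDerivAt (fun x => u x ^ 2 / mp ν x) 0 x := by
    intro x hx
    have hm := mp_pos ν hx
    have hd := ((hasDerivAt_gR_d ν hx).mul (hthd x hx).cos).add
      ((hasDerivAt_gI_d ν hx).mul (hthd x hx).sin)
    have hd2 : HasDerivAt u (u x * mr ν x / (2 * x * mp ν x)) x := by
      refine hd.congr_deriv ?_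
      have hw := wron_d ν hx
      have : pw ν x = (gR ν x * dI ν x - gI ν x * dR ν x) / (x * mp ν x) := by
        rw [hw]; unfold pw; field_simp
      rw [this]
      have hm' : gR ν x ^ 2 + gI ν x ^ 2 ≠ 0 := hm.ne'
      simp only [hu]
      unfold mp mr
      field_simp
      ring
    refine ((hd2.pow 2).div (hasDerivAt_mp ν hx) hm.ne').congr_deriv ?_
    simp only [Pi.pow_apply]
    field_simp
    ring
  have hu0 : ∀ x, 0 < x → u x = 0 := by
    intro x hx
    have h := const_Ioi hud hx hy0m.1
    simp only [(hnear y0 hy0m).1] at h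
    have hm := mp_pos ν hx
    field_simp at h
    simpa using h
  have hv2 : ∀ x, 0 < x → v x ^ 2 = mp ν x := by
    intro x hx
    have h1 : u x ^ 2 + v x ^ 2 = mp ν x := by
      simp only [hu, hv, mp]
      linear_combination (gR ν x ^ 2 + gI ν x ^ 2) * sin_sq_add_cos_sq (th x)
    rw [hu0 x hx] at h1; linarith
  have hvc : ContinuousOn v (Ioi 0) := by
    intro x hx
    have hx' : 0 < x := hx
    exact ((((hasDerivAt_gR_d ν hx').mul (hthd x hx').sin).sub
      ((hasDerivAt_gI_d ν hx').mul (hthd x hx').cos)).continuousAt).continuousWithinAt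
  have hv0 : ∀ x, 0 < x → 0 < v x := by
    intro x hx
    by_contra hcon
    push Not at hcon
    have h := isPreconnected_Ioi.intermediate_value (show x ∈ Ioi (0:ℝ) from hx)
      (show y0 ∈ Ioi (0:ℝ) from hy0m.1) hvc
    obtain ⟨z, hz, hz0⟩ := h ⟨hcon, (hnear y0 hy0m).2.le⟩
    have := hv2 z hz
    have := mp_pos ν hz
    simp [hz0] at *
    linarith
  refine ⟨th, v, hthd, ?_, fun x hx => ⟨hv0 x hx, hv2 x hx, ?_, ?_⟩⟩
  · have : Tendsto (fun x => arctan (q x)) (𝓝[>] 0) (𝓝 0) := by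
      have := (continuous_arctan.tendsto 0).comp hq0
      rw [arctan_zero] at this
      exact this
    refine this.congr' ?_
    filter_upwards [Ioo_mem_nhdsGT hε0] with x hx
    exact (hthq x hx).symm
  · have := hu0 x hx
    simp only [hu] at this
    simp only [hv]
    linear_combination cos (th x) * this - gR ν x * sin_sq_add_cos_sq (th x)
  · have := hu0 x hx
    simp only [hu] at this
    simp only [hv]
    linear_combination sin (th x) * this - gI ν x * sin_sq_add_cos_sq (th x)

noncomputable def cF (ν μ x : ℝ) : ℝ := gR ν x * gI μ x - gI ν x * gR μ x

lemma pw_mono {ν μ : ℝ} (hν : 0 ≤ ν) (h : ν ≤ μ) {x : ℝ} (hx : 0 < x) : pw μ x ≤ pw ν x := by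
  have h1 := mp_mono hν h hx
  have h2 := mp_pos ν hx
  unfold pw
  gcongr

/-- If the moduli agree near a point and phases agree, contradiction. -/
lemma not_eq_near {ν μ x : ℝ} (hν : 0 ≤ ν) (h : ν < μ) (hx : 0 < x)
    (h1 : ∀ᶠ y in 𝓝 x, gR ν y = gR μ y) (h2 : ∀ᶠ y in 𝓝 x, gI ν y = gI μ y) : False := by
  have key : ∀ (f d g e : ℝ → ℝ), (∀ y, 0 < y → HasDerivAt f (d y / y) y) →
      (∀ y, 0 < y → HasDerivAt d ((ν ^ 2 - y ^ 2) * f y / y) y) →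
      (∀ y, 0 < y → HasDerivAt g (e y / y) y) →
      (∀ y, 0 < y → HasDerivAt e ((μ ^ 2 - y ^ 2) * g y / y) y) →
      (∀ᶠ y in 𝓝 x, f y = g y) → f x = 0 := by
    intro f d g e hf hd hg he heq
    have hp : ∀ᶠ y in 𝓝 x, 0 < y := eventually_gt_nhds hx
    have hde : ∀ᶠ y in 𝓝 x, d y = e y := by
      filter_upwards [heq.eventually_nhds, hp] with y hy hy0
      have h3 := (hf y hy0).congr_of_eventuallyEq (f₁ := g) (by
        filter_upwards [hy] with z hz; exact hz.symm)
      have := h3.unique (hg y hy0)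
      field_simp at this
      exact this
    have h3 := (hd x hx).congr_of_eventuallyEq (f₁ := e) (by
        filter_upwards [hde] with z hz; exact hz.symm)
    have h4 := h3.unique (he x hx)
    have h5 := heq.self_of_nhds
    rw [← h5] at h4
    field_simp at h4
    have h6 : (μ ^ 2 - ν ^ 2) * f x = 0 := by linear_combination -h4
    rcases mul_eq_zero.1 h6 with h7 | h7
    · nlinarith
    · exact h7
  have e1 := key (gR ν) (dR ν) (gR μ) (dR μ) (fun y hy => hasDerivAt_gR_d ν hy)
    (fun y hy => hasDerivAt_dR ν hy) (fun y hy => hasDerivAt_gR_d μ hy)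
    (fun y hy => hasDerivAt_dR μ hy) h1
  have e2 := key (gI ν) (dI ν) (gI μ) (dI μ) (fun y hy => hasDerivAt_gI_d ν hy)
    (fun y hy => hasDerivAt_dI ν hy) (fun y hy => hasDerivAt_gI_d μ hy)
    (fun y hy => hasDerivAt_dI μ hy) h2
  have := mp_pos ν hx
  unfold mp at this
  rw [e1, e2] at this
  norm_num at this

lemma cF_two {ν : ℝ} (hν : 0 ≤ ν) {x : ℝ} (hx : 0 < x) : cF ν (ν + 2) x < 0 := by
  have h1 := gR_rec (ν + 1) hx
  have h2 := gI_rec (ν + 1) hx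
  have h3 := wron ν hx
  rw [add_sub_cancel_right, show ν + 1 + 1 = ν + 2 by ring] at h1 h2
  have : cF ν (ν + 2) x = - (2 * (ν + 1) / x * (2 / π / x)) := by
    rw [← h3]
    unfold cF
    have a1 : gR (ν + 2) x = 2 * (ν + 1) / x * gR (ν + 1) x - gR ν x := by linarith
    have a2 : gI (ν + 2) x = 2 * (ν + 1) / x * gI (ν + 1) x - gI ν x := by linarith
    rw [a1, a2]; field_simp; ring
  rw [this]
  have : 0 < 2 * (ν + 1) / x * (2 / π / x) := by positivity
  linarith

lemma cF_neg {ν μ : ℝ} (hν : 0 ≤ ν) (h : ν < μ) (h2 : μ ≤ ν + 2) {x : ℝ} (hx : 0 < x) :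
    cF ν μ x < 0 := by
  obtain ⟨t, v, ht, ht0, hv⟩ := exists_phase hν
  obtain ⟨s, w, hs, hs0, hw⟩ := exists_phase (hν.trans h.le)
  obtain ⟨r, z, hr, hr0, hz⟩ := exists_phase (show 0 ≤ ν + 2 by linarith)
  have m1 : MonotoneOn (fun y => t y - s y) (Ioi 0) :=
    mono_Ioi (fun y hy => (ht y hy).sub (hs y hy)) (fun y hy => by
      linarith [pw_mono hν h.le hy])
  have m2 : MonotoneOn (fun y => s y - r y) (Ioi 0) :=
    mono_Ioi (fun y hy => (hs y hy).sub (hr y hy)) (fun y hy => by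
      linarith [pw_mono (hν.trans h.le) h2 hy])
  have l1 : Tendsto (fun y => t y - s y) (𝓝[>] 0) (𝓝 0) := by simpa using ht0.sub hs0
  have l2 : Tendsto (fun y => s y - r y) (𝓝[>] 0) (𝓝 0) := by simpa using hs0.sub hr0
  have l3 : Tendsto (fun y => t y - r y) (𝓝[>] 0) (𝓝 0) := by simpa using ht0.sub hr0
  -- upper bound
  have hup : t x - r x < π := by
    by_contra hcon
    push Not at hcon
    have hc : ContinuousOn (fun y => t y - r y) (Ioi 0) := fun y hy =>
      (((ht y hy).sub (hr y hy)).continuousAt).continuousWithinAt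
    obtain ⟨y, hy1, hy2⟩ := ((l3.eventually (eventually_lt_nhds pi_pos)).and
      self_mem_nhdsWithin).exists
    obtain ⟨p, hp, hp0⟩ := isPreconnected_Ioi.intermediate_value hy2
      (show x ∈ Ioi (0:ℝ) from hx) hc ⟨hy1.le, hcon⟩
    have hp' : 0 < p := hp
    have hF := cF_two hν hp'
    obtain ⟨_, _, a1, a2⟩ := hv p hp'
    obtain ⟨_, _, b1, b2⟩ := hz p hp'
    have : cF ν (ν + 2) p = - (v p * z p * sin (t p - r p)) := by
      unfold cF; rw [a1, a2, b1, b2, sin_sub]; ring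
    simp only at hp0
    rw [this, hp0, sin_pi] at hF
    simp at hF
  have hlow : 0 < t x - s x := by
    refine lt_of_le_of_ne (mono_ge_lim m1 l1 hx) fun h0 => ?_
    have hz0 : ∀ y ∈ Ioo 0 x, t y - s y = 0 := by
      intro y hy
      have c1 := mono_ge_lim m1 l1 hy.1
      have c2 := m1 hy.1 hx hy.2.le
      simp only at c1 c2
      linarith
    have hpe : ∀ y ∈ Ioo 0 x, gR ν y = gR μ y ∧ gI ν y = gI μ y := by
      intro y hy
      have d1 : HasDerivAt (fun y => t y - s y) 0 y := by
        refine (hasDerivAt_const y (0:ℝ)).congr_of_eventuallyEq ?_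
        filter_upwards [Ioo_mem_nhds hy.1 hy.2] with p hp
        exact hz0 p hp
      have d2 := d1.unique ((ht y hy.1).sub (hs y hy.1))
      obtain ⟨a0, a00, a1, a2⟩ := hv y hy.1
      obtain ⟨b0, b00, b1, b2⟩ := hw y hy.1
      have p1 := mp_pos ν hy.1
      have p2 := mp_pos μ hy.1
      have hy0 := hy.1
      have e : mp ν y = mp μ y := by
        unfold pw at d2
        field_simp at d2
        have hpi := pi_pos
        linarith
      have e2 : v y = w y := by
        rw [← a00, ← b00] at e
        nlinarith
      have e3 : t y = s y := by linarith [hz0 y hy]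
      rw [a1, a2, b1, b2, e2, e3]
      exact ⟨rfl, rfl⟩
    have hx2 : x / 2 ∈ Ioo 0 x := ⟨by positivity, by linarith⟩
    refine not_eq_near (x := x / 2) hν h hx2.1 ?_ ?_
    · filter_upwards [Ioo_mem_nhds hx2.1 hx2.2] with p hp using (hpe p hp).1
    · filter_upwards [Ioo_mem_nhds hx2.1 hx2.2] with p hp using (hpe p hp).2
  have hle := mono_ge_lim m2 l2 hx
  obtain ⟨v0, _, a1, a2⟩ := hv x hx
  obtain ⟨w0, _, b1, b2⟩ := hw x hx
  have : cF ν μ x = - (v x * w x * sin (t x - s x)) := by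
    unfold cF; rw [a1, a2, b1, b2, sin_sub]; ring
  rw [this]
  have hsin : 0 < sin (t x - s x) := sin_pos_of_pos_of_lt_pi hlow (by linarith)
  have : 0 < v x * w x * sin (t x - s x) := by positivity
  linarith

/-- Phase tends to infinity. -/
lemma phase_atTop {ν : ℝ} {th : ℝ → ℝ} (hth : ∀ x, 0 < x → HasDerivAt th (pw ν x) x) :
    Tendsto th atTop atTop := by
  have h1 := (asym ν).1
  have h2 : ∀ᶠ x in atTop, x * mp ν x < 4 / π :=
    h1.eventually (eventually_lt_nhds (by gcongr; norm_num))
  obtain ⟨A, hA⟩ := eventually_atTop.1 h2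
  set B := max A 1 with hB
  have hB1 : 1 ≤ B := le_max_right _ _
  have hw : ∀ x, B ≤ x → 1 / 2 ≤ pw ν x := by
    intro x hx
    have hx0 : 0 < x := by linarith
    have := hA x ((le_max_left _ _).trans hx)
    have hm := mp_pos ν hx0
    have hp := pi_pos
    unfold pw
    rw [div_le_div_iff₀ (by norm_num) (by positivity)]
    rw [lt_div_iff₀ hp] at this
    nlinarith
  have hmono : MonotoneOn (fun x => th x - x / 2) (Ici B) := by
    refine monotoneOn_of_hasDerivWithinAt_nonneg (f' := fun x => pw ν x - 1 / 2) (convex_Ici B) ?_ ?_ ?_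
    · intro x hx
      have hx' : B ≤ x := hx
      exact ((hth x (by linarith)).continuousAt.sub (by fun_prop)).continuousWithinAt
    · intro x hx
      rw [interior_Ici] at hx
      have hx' : B < x := hx
      exact ((hth x (by linarith)).sub ((hasDerivAt_id' x).div_const 2)).hasDerivWithinAt
    · intro x hx
      rw [interior_Ici] at hx
      linarith [hw x (le_of_lt hx)]
  refine tendsto_atTop_mono' atTop (f₁ := fun x => x / 2 + (th B - B / 2)) ?_ ?_
  · filter_upwards [eventually_ge_atTop B] with x hx
    have := hmono (self_mem_Ici (a := B)) hx hx
    simp only at this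
    linarith
  · exact tendsto_atTop_add_const_right _ _ (tendsto_id.atTop_div_const (by norm_num))

lemma zeros_unbdd {ν : ℝ} (hν : 0 ≤ ν) {x : ℝ} (hx : 0 < x) :
    (∃ y, x < y ∧ gR ν y = 0) ∧ (∃ y, x < y ∧ gI ν y = 0) := by
  obtain ⟨t, v, ht, ht0, hv⟩ := exists_phase hν
  have htop := phase_atTop ht
  have hex : ∀ c, t x < c → ∃ y, x < y ∧ t y = c := by
    intro c hc
    obtain ⟨z, hz1, hz2⟩ := ((htop.eventually (eventually_ge_atTop c)).and
      (eventually_ge_atTop x)).exists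
    have hcont : ContinuousOn t (Icc x z) := fun y hy =>
      (ht y (by linarith [hy.1])).continuousAt.continuousWithinAt
    obtain ⟨y, hy, hyc⟩ := intermediate_value_Icc hz2 hcont ⟨hc.le, hz1⟩
    refine ⟨y, lt_of_le_of_ne hy.1 ?_, hyc⟩
    rintro rfl
    linarith
  obtain ⟨n, hn⟩ := exists_nat_gt (t x / π)
  rw [div_lt_iff₀ pi_pos] at hn
  constructor
  · obtain ⟨y, hy, hyt⟩ := hex _ hn
    refine ⟨y, hy, ?_⟩
    rw [(hv y (hx.trans hy)).2.2.1, hyt, sin_nat_mul_pi, mul_zero]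
  · obtain ⟨y, hy, hyt⟩ := hex (n * π + π / 2) (by linarith [pi_pos])
    refine ⟨y, hy, ?_⟩
    rw [(hv y (hx.trans hy)).2.2.2, hyt, cos_add_pi_div_two, sin_nat_mul_pi]; simp

lemma zero_right {g : ℝ → ℝ} {d c : ℝ} (h : HasDerivAt g d c) (hd : 0 < d) (h0 : g c = 0) :
    (∀ᶠ y in 𝓝[>] c, 0 < g y) ∧ (∀ᶠ y in 𝓝[<] c, g y < 0) := by
  have hs := (hasDerivAt_iff_tendsto_slope.1 h).eventually (eventually_gt_nhds hd)
  have key : ∀ y, slope g c y = (y - c)⁻¹ * g y := fun y => by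
    rw [slope_def_field, h0, sub_zero, div_eq_inv_mul]
  constructor
  · have h1 := hs.filter_mono (nhdsWithin_mono c (show Ioi c ⊆ {c}ᶜ from fun y hy => ne_of_gt hy))
    filter_upwards [h1, self_mem_nhdsWithin] with y hy hy2
    rw [key] at hy
    have : 0 < (y - c)⁻¹ := inv_pos.2 (sub_pos.2 hy2)
    exact (pos_iff_pos_of_mul_pos hy).1 this
  · have h1 := hs.filter_mono (nhdsWithin_mono c (show Iio c ⊆ {c}ᶜ from fun y hy => ne_of_lt hy))
    filter_upwards [h1, self_mem_nhdsWithin] with y hy hy2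
    rw [key] at hy
    have : (y - c)⁻¹ < 0 := inv_lt_zero.2 (sub_neg.2 hy2)
    exact (neg_iff_neg_of_mul_pos hy).1 this

/-- constant sign on an interval without zeros -/
lemma sign_const {f : ℝ → ℝ} {s : Set ℝ} (hs : IsPreconnected s) (hc : ContinuousOn f s)
    (h0 : ∀ x ∈ s, f x ≠ 0) {a : ℝ} (ha : a ∈ s) (hfa : 0 < f a) : ∀ x ∈ s, 0 < f x := by
  intro x hx
  by_contra hcon
  push Not at hcon
  obtain ⟨z, hz, hz0⟩ := hs.intermediate_value hx ha hc ⟨hcon, hfa.le⟩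
  exact h0 z hz hz0

lemma first_zero {f : ℝ → ℝ} {a b : ℝ} (hab : a ≤ b) (hc : ContinuousOn f (Icc a b))
    (ha : 0 < f a) (hb : f b ≤ 0) : ∃ c, a < c ∧ c ≤ b ∧ f c = 0 ∧ ∀ y ∈ Ico a c, 0 < f y := by
  set S := Icc a b ∩ f ⁻¹' {0} with hS
  have hcl : IsClosed S := hc.preimage_isClosed_of_isClosed isClosed_Icc isClosed_singleton
  have hcomp : IsCompact S := isCompact_Icc.of_isClosed_subset hcl inter_subset_left
  have hne : S.Nonempty := by
    obtain ⟨z, hz, hz0⟩ := intermediate_value_Icc' hab hc ⟨hb, ha.le⟩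
    exact ⟨z, hz, hz0⟩
  obtain ⟨c, ⟨hc1, hc2⟩, hmin⟩ := hcomp.exists_isLeast hne
  have hc2' : f c = 0 := hc2
  have hac : a < c := lt_of_le_of_ne hc1.1 (by rintro rfl; linarith)
  refine ⟨c, hac, hc1.2, hc2', ?_⟩
  refine sign_const isPreconnected_Ico (hc.mono ?_) ?_ ⟨le_rfl, hac⟩ ha
  · intro y hy; exact ⟨hy.1, hy.2.le.trans hc1.2⟩
  · intro y hy h0
    have := hmin (show y ∈ S from ⟨⟨hy.1, hy.2.le.trans hc1.2⟩, h0⟩)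
    linarith [hy.2]

lemma no_two_zeros {g g' : ℝ → ℝ} {a b : ℝ} (hab : a < b)
    (hd : ∀ x ∈ Icc a b, HasDerivAt g (g' x) x) (hp : ∀ x ∈ Icc a b, g x = 0 → 0 < g' x)
    (ha : g a = 0) (hb : g b = 0) : False := by
  have hA : a ∈ Icc a b := ⟨le_rfl, hab.le⟩
  have h1 := (zero_right (hd a hA) (hp a hA ha) ha).1
  obtain ⟨y, hy, hy2⟩ := (h1.and (Ioo_mem_nhdsGT hab)).exists
  obtain ⟨c, hc1, hc2, hc3, hc4⟩ := first_zero (f := g) hy2.2.le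
    (fun z hz => (hd z ⟨hy2.1.le.trans hz.1, hz.2⟩).continuousAt.continuousWithinAt) hy hb.le
  have hC : c ∈ Icc a b := ⟨(hy2.1.trans hc1).le, hc2⟩
  have h2 := (zero_right (hd c hC) (hp c hC hc3) hc3).2
  obtain ⟨z, hz, hz2⟩ := (h2.and (Ioo_mem_nhdsLT hc1)).exists
  linarith [hc4 z ⟨hz2.1.le, hz2.2⟩]

lemma interlace_half_pos {f g f' g' : ℝ → ℝ} (hf : ∀ x, 0 < x → HasDerivAt f (f' x) x)
    (hg : ∀ x, 0 < x → HasDerivAt g (g' x) x)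
    (H1 : ∀ x, 0 < x → f x = 0 → f' x * g x < 0)
    (H2 : ∀ x, 0 < x → g x = 0 → 0 < g' x * f x)
    {a b : ℝ} (ha : 0 < a) (hab : a < b) (fa : f a = 0) (fb : f b = 0)
    (hpos : ∀ x ∈ Ioo a b, 0 < f x) : ∃! x, x ∈ Ioo a b ∧ g x = 0 := by
  have hb : 0 < b := ha.trans hab
  have ga : g a < 0 := by
    have h := H1 a ha fa
    rcases lt_trichotomy (f' a) 0 with h1 | h1 | h1
    · exfalso
      have h2 := (zero_right (hf a ha).neg (by linarith) (by simp [fa])).1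
      obtain ⟨y, hy, hy2⟩ := (h2.and (Ioo_mem_nhdsGT hab)).exists
      have := hpos y hy2
      simp at hy; linarith
    · rw [h1] at h; simp at h
    · nlinarith
  have gb : 0 < g b := by
    have h := H1 b hb fb
    rcases lt_trichotomy (f' b) 0 with h1 | h1 | h1
    · nlinarith
    · rw [h1] at h; simp at h
    · exfalso
      have h2 := (zero_right (hf b hb) h1 fb).2
      obtain ⟨y, hy, hy2⟩ := (h2.and (Ioo_mem_nhdsLT hab)).exists
      have := hpos y hy2
      linarith
  have hcg : ContinuousOn g (Icc a b) := fun x hx =>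
    (hg x (by linarith [hx.1])).continuousAt.continuousWithinAt
  obtain ⟨z, hz, hz0⟩ := intermediate_value_Icc hab.le hcg ⟨ga.le, gb.le⟩
  have hzI : z ∈ Ioo a b := by
    refine ⟨lt_of_le_of_ne hz.1 ?_, lt_of_le_of_ne hz.2 ?_⟩
    · rintro rfl; linarith
    · rintro rfl; linarith
  have huniq : ∀ p ∈ Ioo a b, ∀ q ∈ Ioo a b, g p = 0 → g q = 0 → p < q → False := by
    intro p hp q hq gp gq hpq
    refine no_two_zeros hpq (fun x hx => hg x (by linarith [hp.1, hx.1])) ?_ gp gq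
    intro x hx gx
    have h1 := H2 x (by linarith [hp.1, hx.1]) gx
    have h2 := hpos x ⟨by linarith [hp.1, hx.1], by linarith [hq.2, hx.2]⟩
    exact (pos_iff_pos_of_mul_pos h1).2 h2
  refine ⟨z, ⟨hzI, hz0⟩, ?_⟩
  rintro y ⟨hy, hy0⟩
  rcases lt_trichotomy y z with h | h | h
  · exact (huniq y hy z hzI hy0 hz0 h).elim
  · exact h
  · exact (huniq z hzI y hy hz0 hy0 h).elim

lemma half_of {f g f' g' : ℝ → ℝ} (hf : ∀ x, 0 < x → HasDerivAt f (f' x) x)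
    (hg : ∀ x, 0 < x → HasDerivAt g (g' x) x)
    (H1 : ∀ x, 0 < x → f x = 0 → f' x * g x < 0)
    (H2 : ∀ x, 0 < x → g x = 0 → 0 < g' x * f x) : InterlaceHalf f g (Ioi 0) := by
  intro a ha b hb hab fa fb hne
  have ha' : 0 < a := ha
  have hcf : ContinuousOn f (Ioo a b) := fun x hx =>
    (hf x (by linarith [hx.1])).continuousAt.continuousWithinAt
  have hm : (a + b) / 2 ∈ Ioo a b := ⟨by linarith, by linarith⟩
  rcases lt_or_gt_of_ne (hne _ hm) with h | h
  · have hp := sign_const (f := fun x => - f x) isPreconnected_Ioo hcf.neg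
      (fun x hx h0 => hne x hx (by linarith)) hm (by linarith)
    have := interlace_half_pos (f := fun x => - f x) (g := fun x => - g x) (fun x hx => (hf x hx).neg)
      (fun x hx => (hg x hx).neg) (fun x hx h0 => by
        have := H1 x hx (by linarith)
        linarith) (fun x hx h0 => by
        have := H2 x hx (by linarith)
        linarith) ha' hab (by simp [fa]) (by simp [fb]) hp
    simpa using this
  · exact interlace_half_pos hf hg H1 H2 ha' hab fa fb (sign_const isPreconnected_Ioo hcf hne hm h)

lemma interlaced_of {f g f' g' : ℝ → ℝ} (hf : ∀ x, 0 < x → HasDerivAt f (f' x) x)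
    (hg : ∀ x, 0 < x → HasDerivAt g (g' x) x)
    (H1 : ∀ x, 0 < x → f x = 0 → f' x * g x < 0)
    (H2 : ∀ x, 0 < x → g x = 0 → 0 < g' x * f x) : InterlacedOn f g (Ioi 0) := by
  refine ⟨half_of hf hg H1 H2, ?_⟩
  have := half_of (f := g) (g := fun x => - f x) hg (fun x hx => (hf x hx).neg)
    (fun x hx h0 => by linarith [H2 x hx h0]) (fun x hx h0 => by
      have := H1 x hx (by linarith)
      linarith)
  intro a ha b hb hab ga gb hne
  simpa using this a ha b hb hab ga gb hne

lemma interlaced_congr {f g f₁ g₁ : ℝ → ℝ} (hf : ∀ x, 0 < x → f x = f₁ x)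
    (hg : ∀ x, 0 < x → g x = g₁ x) (h : InterlacedOn f₁ g₁ (Ioi 0)) :
    InterlacedOn f g (Ioi 0) := by
  have key : ∀ {f g f₁ g₁ : ℝ → ℝ}, (∀ x, 0 < x → f x = f₁ x) →
      (∀ x, 0 < x → g x = g₁ x) → InterlaceHalf f₁ g₁ (Ioi 0) → InterlaceHalf f g (Ioi 0) := by
    intro f g f₁ g₁ hf hg h a ha b hb hab fa fb hne
    have ha' : 0 < a := ha
    obtain ⟨z, ⟨hz, hz0⟩, hu⟩ := h a ha b hb hab (by rw [← hf a ha, fa]) (by rw [← hf b hb, fb])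
      (fun x hx => by rw [← hf x (by linarith [hx.1])]; exact hne x hx)
    refine ⟨z, ⟨hz, by rw [hg z (by linarith [hz.1]), hz0]⟩, ?_⟩
    rintro y ⟨hy, hy0⟩
    exact hu y ⟨hy, by rw [← hg y (by linarith [hy.1]), hy0]⟩
  exact ⟨key hf hg h.1, key hg hf h.2⟩

lemma rot_signs {ν μ : ℝ} (hν : 0 ≤ ν) (h : ν < μ) (h2 : μ ≤ ν + 2) (c s : ℝ)
    (hcs : c ^ 2 + s ^ 2 = 1) {x : ℝ} (hx : 0 < x) :
    (c * gR ν x - s * gI ν x = 0 →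
      (c * dR ν x - s * dI ν x) * (c * gR μ x - s * gI μ x) < 0) ∧
    (c * gR μ x - s * gI μ x = 0 →
      0 < (c * dR μ x - s * dI μ x) * (c * gR ν x - s * gI ν x)) := by
  have hF := cF_neg hν h h2 hx
  have w1 := wron_d ν hx
  have w2 := wron_d μ hx
  have hp : 0 < 2 / π := by positivity
  have e : cF ν μ x = (c * gR ν x - s * gI ν x) * (s * gR μ x + c * gI μ x)
      - (c * gR μ x - s * gI μ x) * (s * gR ν x + c * gI ν x) := by
    unfold cF; linear_combination (-(gR ν x * gI μ x - gI ν x * gR μ x)) * hcs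
  have f : ∀ κ, (c * gR κ x - s * gI κ x) * (s * dR κ x + c * dI κ x)
      - (c * dR κ x - s * dI κ x) * (s * gR κ x + c * gI κ x)
      = gR κ x * dI κ x - gI κ x * dR κ x := by
    intro κ; linear_combination (gR κ x * dI κ x - gI κ x * dR κ x) * hcs
  constructor
  · intro h0
    have f1 := f ν
    rw [h0, w1] at f1
    rw [e, h0] at hF
    set A := c * dR ν x - s * dI ν x
    set B := c * gR μ x - s * gI μ x
    set D := s * gR ν x + c * gI ν x
    have a1 : A * D < 0 := by linarith
    have a2 : 0 < B * D := by linarith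
    by_contra hcon
    push Not at hcon
    nlinarith [mul_neg_of_neg_of_pos a1 a2, mul_nonneg hcon (sq_nonneg D)]
  · intro h0
    have f1 := f μ
    rw [h0, w2] at f1
    rw [e, h0] at hF
    set A := c * dR μ x - s * dI μ x
    set B := c * gR ν x - s * gI ν x
    set D := s * gR μ x + c * gI μ x
    have a1 : A * D < 0 := by linarith
    have a2 : B * D < 0 := by linarith
    by_contra hcon
    push Not at hcon
    nlinarith [mul_pos_of_neg_of_neg a1 a2, mul_nonneg (neg_nonneg.2 hcon) (sq_nonneg D)]

lemma part_one {ν : ℝ} (hν : 0 ≤ ν) (δ : ℝ) {a : ℝ} (ha : 0 < a) (ha2 : a ≤ 2) :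
    InterlacedOn (cylinder δ ν) (cylinder δ (ν + a)) (Ioi 0) := by
  have hcs : cos δ ^ 2 + sin δ ^ 2 = 1 := by rw [add_comm]; exact sin_sq_add_cos_sq δ
  have hcyl : ∀ κ x, 0 < x → cylinder δ κ x = cos δ * gR κ x - sin δ * gI κ x := by
    intro κ x hx
    rw [cylinder, gR_eq_J κ hx, gI_eq_Y κ hx]
  have hd : ∀ κ x, 0 < x → HasDerivAt (fun x => cos δ * gR κ x - sin δ * gI κ x)
      ((cos δ * dR κ x - sin δ * dI κ x) / x) x := by
    intro κ x hx
    refine (((hasDerivAt_gR_d κ hx).const_mul _).sub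
      ((hasDerivAt_gI_d κ hx).const_mul _)).congr_deriv ?_
    ring
  refine interlaced_congr (hcyl ν) (hcyl (ν + a)) ?_
  refine interlaced_of (hd ν) (hd (ν + a)) ?_ ?_
  · intro x hx h0
    have := (rot_signs hν (show ν < ν + a by linarith) (by linarith) _ _ hcs hx).1 h0
    rw [div_mul_eq_mul_div]
    exact div_neg_of_neg_of_pos this hx
  · intro x hx h0
    have := (rot_signs hν (show ν < ν + a by linarith) (by linarith) _ _ hcs hx).2 h0
    rw [div_mul_eq_mul_div]
    exact div_pos this hx

/-- A solution of Bessel's equation with its Euler derivative. -/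
def Sol (ν : ℝ) (f d : ℝ → ℝ) : Prop := ∀ x, 0 < x →
  HasDerivAt f (d x / x) x ∧ HasDerivAt d ((ν ^ 2 - x ^ 2) * f x / x) x

lemma sol_W {ν μ : ℝ} {f d g e : ℝ → ℝ} (hf : Sol ν f d) (hg : Sol μ g e) {x : ℝ} (hx : 0 < x) :
    HasDerivAt (fun y => f y * e y - d y * g y) ((μ ^ 2 - ν ^ 2) * (f x * g x) / x) x := by
  refine (((hf x hx).1.mul (hg x hx).2).sub ((hf x hx).2.mul (hg x hx).1)).congr_deriv ?_
  field_simp; ring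

lemma sol_prod {ν : ℝ} {f d : ℝ → ℝ} (hf : Sol ν f d) {x : ℝ} (hx : 0 < x) :
    HasDerivAt (fun y => f y * d y) ((d x ^ 2 + (ν ^ 2 - x ^ 2) * f x ^ 2) / x) x := by
  refine ((hf x hx).1.mul (hf x hx).2).congr_deriv ?_
  field_simp

lemma W_prop {ν μ : ℝ} (hm : ν ^ 2 < μ ^ 2) {f d g e : ℝ → ℝ} (hf : Sol ν f d) (hg : Sol μ g e)
    (S1 : ∀ x, 0 < x → f x = 0 → d x * g x < 0) (S2 : ∀ x, 0 < x → g x = 0 → 0 < e x * f x)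
    (U : ∀ x, 0 < x → ∃ y, x < y ∧ f y = 0) {p x : ℝ} (hp : 0 < p) (hpx : p ≤ x)
    (hW : 0 < f p * e p - d p * g p) : 0 < f x * e x - d x * g x := by
  by_contra hcon
  push Not at hcon
  set W : ℝ → ℝ := fun y => f y * e y - d y * g y with hWd
  have hz : ∀ y, 0 < y → f y * g y = 0 → 0 < W y := by
    intro y hy h0
    rcases mul_eq_zero.1 h0 with h | h
    · have := S1 y hy h
      simp only [hWd, h]; linarith
    · have := S2 y hy h
      simp only [hWd, h]; linarith
  have hWc : ∀ y, 0 < y → ContinuousAt W y := fun y hy => (sol_W hf hg hy).continuousAt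
  obtain ⟨c, hc1, hc2, hc3, hc4⟩ := first_zero (f := W) hpx
    (fun y hy => (hWc y (by linarith [hy.1])).continuousWithinAt) hW hcon
  have hc0 : 0 < c := hp.trans hc1
  have hmm : 0 < μ ^ 2 - ν ^ 2 := by linarith
  rcases lt_trichotomy (f c * g c) 0 with h | h | h
  · obtain ⟨y, hy, hy0⟩ := U c hc0
    have hcont : ∀ y, 0 < y → ContinuousAt (fun y => -(f y * g y)) y := fun y hy =>
      (((hf y hy).1.continuousAt).mul ((hg y hy).1.continuousAt)).neg
    obtain ⟨q, hq1, hq2, hq3, hq4⟩ := first_zero (f := fun y => -(f y * g y)) hy.le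
      (fun z hz => (hcont z (by linarith [hz.1])).continuousWithinAt) (by linarith)
      (by simp [hy0])
    have hq := hz q (by linarith) (by linarith)
    have hanti : AntitoneOn W (Icc c q) := by
      refine antitoneOn_of_hasDerivWithinAt_nonpos (convex_Icc c q)
        (f' := fun x => (μ ^ 2 - ν ^ 2) * (f x * g x) / x) ?_ ?_ ?_
      · intro z hz; exact (hWc z (by linarith [hz.1])).continuousWithinAt
      · intro z hz
        rw [interior_Icc] at hz
        exact (sol_W hf hg (by linarith [hz.1])).hasDerivWithinAt
      · intro z hz
        rw [interior_Icc] at hz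
        have h1 := hq4 z ⟨hz.1.le, hz.2⟩
        have hz0 : 0 < z := by linarith [hz.1]
        refine div_nonpos_of_nonpos_of_nonneg ?_ hz0.le
        nlinarith
    have := hanti ⟨le_rfl, hq1.le⟩ ⟨hq1.le, le_rfl⟩ hq1.le
    linarith
  · have := hz c hc0 h
    linarith
  · have h2 := (zero_right (sol_W hf hg hc0) (by positivity) hc3).2
    obtain ⟨z, hz1, hz2⟩ := (h2.and (Ioo_mem_nhdsLT hc1)).exists
    have := hc4 z ⟨hz2.1.le, hz2.2⟩
    simp only [hWd] at this
    linarith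

lemma final_deriv {ν μ : ℝ} {f d g e : ℝ → ℝ} (hf : Sol ν f d) (hg : Sol μ g e)
    (Wd : ∀ x, 0 < x → d x = 0 → 0 < f x * e x - d x * g x)
    (We : ∀ x, 0 < x → e x = 0 → 0 < f x * e x - d x * g x)
    (Zd : ∀ x, 0 < x → d x = 0 → ν ^ 2 < x ^ 2)
    (Ze : ∀ x, 0 < x → e x = 0 → μ ^ 2 < x ^ 2) :
    InterlacedOn (fun x => d x / x) (fun x => e x / x) (Ioi 0) := by
  have hd : ∀ x, 0 < x → HasDerivAt (fun x => d x / x)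
      (((ν ^ 2 - x ^ 2) * f x - d x) / x ^ 2) x := by
    intro x hx
    refine ((hf x hx).2.div (hasDerivAt_id' x) hx.ne').congr_deriv ?_
    field_simp
  have he : ∀ x, 0 < x → HasDerivAt (fun x => e x / x)
      (((μ ^ 2 - x ^ 2) * g x - e x) / x ^ 2) x := by
    intro x hx
    refine ((hg x hx).2.div (hasDerivAt_id' x) hx.ne').congr_deriv ?_
    field_simp
  refine interlaced_of hd he ?_ ?_
  · intro x hx h0
    have h0' : d x = 0 := by simpa [hx.ne'] using h0
    have h1 := Wd x hx h0'
    have h2 := Zd x hx h0'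
    rw [h0'] at h1 ⊢
    rw [show ((ν ^ 2 - x ^ 2) * f x - 0) / x ^ 2 * (e x / x) =
      - ((x ^ 2 - ν ^ 2) * (f x * e x) / x ^ 3) by field_simp; ring]
    have : 0 < (x ^ 2 - ν ^ 2) * (f x * e x) / x ^ 3 :=
      div_pos (mul_pos (by linarith) (by linarith)) (by positivity)
    linarith
  · intro x hx h0
    have h0' : e x = 0 := by simpa [hx.ne'] using h0
    have h1 := We x hx h0'
    have h2 := Ze x hx h0'
    rw [h0'] at h1 ⊢
    rw [show ((μ ^ 2 - x ^ 2) * g x - 0) / x ^ 2 * (d x / x) =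
      ((x ^ 2 - μ ^ 2) * (- (d x * g x)) / x ^ 3) by field_simp; ring]
    exact div_pos (mul_pos (by linarith) (by linarith)) (by positivity)

lemma sol_gR (ν : ℝ) : Sol ν (gR ν) (dR ν) := fun _ hx => ⟨hasDerivAt_gR_d ν hx, hasDerivAt_dR ν hx⟩
lemma sol_gI (ν : ℝ) : Sol ν (gI ν) (dI ν) := fun _ hx => ⟨hasDerivAt_gI_d ν hx, hasDerivAt_dI ν hx⟩

lemma id_zero : Tendsto (fun x : ℝ => x) (𝓝[>] 0) (𝓝 0) :=
  tendsto_nhdsWithin_of_tendsto_nhds tendsto_id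

lemma bdd_mul_zero {ν : ℝ} (hν : 0 ≤ ν) {d : ℝ → ℝ} (hd : Tendsto d (𝓝[>] 0) (𝓝 0)) :
    Tendsto (fun x => gR ν x * d x) (𝓝[>] 0) (𝓝 0) := by
  obtain ⟨C, hC⟩ := gR_bdd_near hν
  have h1 : Tendsto (fun x => C * |d x|) (𝓝[>] 0) (𝓝 0) := by
    have := (hd.abs).const_mul C
    simpa using this
  refine squeeze_zero_norm' ?_ h1
  filter_upwards [self_mem_nhdsWithin] with x hx
  rw [Real.norm_eq_abs, abs_mul]
  exact mul_le_mul_of_nonneg_right (hC x hx) (abs_nonneg _)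

lemma dR_zero {ν : ℝ} (hν : 0 ≤ ν) : Tendsto (dR ν) (𝓝[>] 0) (𝓝 0) := by
  have h1 : Tendsto (fun x => ν * gR ν x) (𝓝[>] 0) (𝓝 0) := by
    rcases hν.eq_or_lt with h | h
    · rw [← h]; simp
    · have := (besselJ_tendsto_zero h).const_mul ν
      rw [mul_zero] at this
      refine this.congr' ?_
      filter_upwards [self_mem_nhdsWithin] with x hx
      rw [gR_eq_J ν hx]
  have h2 := bdd_mul_zero (show 0 ≤ ν + 1 by linarith) id_zero
  have h3 := h1.sub h2
  rw [sub_zero] at h3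
  refine h3.congr fun x => ?_
  unfold dR; ring

lemma gR_pos_near {ν : ℝ} (hν : 0 ≤ ν) : ∀ᶠ x in 𝓝[>] 0, 0 < gR ν x := by
  filter_upwards [besselJ_pos_near (show -1 < ν by linarith), self_mem_nhdsWithin] with x hx hx0
  rw [gR_eq_J ν hx0]; exact hx

lemma sol_prod_mono {ν : ℝ} {f d : ℝ → ℝ} (hf : Sol ν f d) :
    MonotoneOn (fun y => f y * d y) (Ioc 0 ν) := by
  refine monotoneOn_of_hasDerivWithinAt_nonneg (convex_Ioc 0 ν)
    (f' := fun x => (d x ^ 2 + (ν ^ 2 - x ^ 2) * f x ^ 2) / x) ?_ ?_ ?_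
  · intro x hx; exact (sol_prod hf hx.1).continuousAt.continuousWithinAt
  · intro x hx
    exact (sol_prod hf (interior_subset hx).1).hasDerivWithinAt
  · intro x hx
    have h := interior_subset hx
    have h0 := h.1
    have : 0 ≤ ν ^ 2 - x ^ 2 := by nlinarith [h.1, h.2]
    positivity

/-- if the product is constant on `(a,b)` with `b ≤ ν` then `f` vanishes there -/
lemma prod_const {ν : ℝ} {f d : ℝ → ℝ} (hf : Sol ν f d) {a b : ℝ} (ha : 0 ≤ a) (hb : b ≤ ν)
    (h : ∀ x ∈ Ioo a b, f x * d x = 0) : ∀ x ∈ Ioo a b, f x = 0 ∧ d x = 0 := by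
  intro x hx
  have hx0 : 0 < x := by linarith [hx.1]
  have d1 : HasDerivAt (fun y => f y * d y) 0 x := by
    refine (hasDerivAt_const x (0:ℝ)).congr_of_eventuallyEq ?_
    filter_upwards [Ioo_mem_nhds hx.1 hx.2] with p hp
    exact h p hp
  have d2 := d1.unique (sol_prod hf hx0)
  have h3 : 0 < ν ^ 2 - x ^ 2 := by nlinarith [hx.2]
  have h4 : d x ^ 2 + (ν ^ 2 - x ^ 2) * f x ^ 2 = 0 := by
    field_simp at d2; linarith
  have h5 : 0 ≤ (ν ^ 2 - x ^ 2) * f x ^ 2 := by positivity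
  have h6 : d x ^ 2 = 0 := by nlinarith [sq_nonneg (d x)]
  have h7 : (ν ^ 2 - x ^ 2) * f x ^ 2 = 0 := by linarith
  refine ⟨?_, by simpa using h6⟩
  rcases mul_eq_zero.1 h7 with h8 | h8
  · linarith
  · simpa using h8

lemma zero_dR {ν : ℝ} (hν : 0 ≤ ν) {x : ℝ} (hx : 0 < x) (h0 : dR ν x = 0) : ν ^ 2 < x ^ 2 := by
  by_contra hcon
  have hxν : x ≤ ν := by
    by_contra h; push Not at h; apply hcon; nlinarith
  have hmono := sol_prod_mono (sol_gR ν)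
  have hl := bdd_mul_zero hν (dR_zero hν)
  have hge : ∀ y ∈ Ioo 0 x, 0 ≤ gR ν y * dR ν y := by
    intro y hy
    refine le_of_tendsto hl ?_
    filter_upwards [Ioo_mem_nhdsGT hy.1] with z hz
    exact hmono ⟨hz.1, by linarith [hz.2, hy.2]⟩ ⟨hy.1, by linarith [hy.2]⟩ hz.2.le
  have hz : ∀ y ∈ Ioo 0 x, gR ν y * dR ν y = 0 := by
    intro y hy
    have h1 := hmono ⟨hy.1, by linarith [hy.2]⟩ ⟨hx, hxν⟩ hy.2.le
    simp only [h0, mul_zero] at h1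
    exact le_antisymm h1 (hge y hy)
  have := prod_const (sol_gR ν) le_rfl hxν hz
  obtain ⟨y, hy1, hy2⟩ := ((gR_pos_near hν).and (Ioo_mem_nhdsGT hx)).exists
  linarith [(this y hy2).1]

lemma part_J {ν : ℝ} (hν : 0 ≤ ν) {b : ℝ} (hb : 0 < b) (hb1 : b ≤ 1) :
    InterlacedOn (fun x => dR ν x / x) (fun x => dR (ν + b) x / x) (Ioi 0) := by
  have hμ : 0 ≤ ν + b := by linarith
  have hm : ν ^ 2 < (ν + b) ^ 2 := by nlinarith
  have S := fun x (hx : 0 < x) => rot_signs hν (show ν < ν + b by linarith) (by linarith) 1 0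
    (by norm_num) hx
  simp only [one_mul, zero_mul, sub_zero] at S
  have hl : Tendsto (fun y => gR ν y * dR (ν + b) y - dR ν y * gR (ν + b) y) (𝓝[>] 0) (𝓝 0) := by
    have := (bdd_mul_zero hν (dR_zero hμ)).sub (bdd_mul_zero hμ (dR_zero hν))
    rw [sub_zero] at this
    refine this.congr fun x => by ring
  have hWp : ∀ x, 0 < x → 0 < gR ν x * dR (ν + b) x - dR ν x * gR (ν + b) x := by
    intro x hx
    obtain ⟨ε, hε, hsub⟩ := mem_nhdsGT_iff_exists_Ioo_subset.1
      (((gR_pos_near hν).and (gR_pos_near hμ)).and (Ioo_mem_nhdsGT hx))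
    have hε0 : (0:ℝ) < ε := hε
    have hmono : StrictMonoOn (fun y => gR ν y * dR (ν + b) y - dR ν y * gR (ν + b) y)
        (Ioo 0 ε) := by
      refine strictMonoOn_of_hasDerivWithinAt_pos (convex_Ioo 0 ε)
        (f' := fun x => ((ν + b) ^ 2 - ν ^ 2) * (gR ν x * gR (ν + b) x) / x) ?_ ?_ ?_
      · intro y hy
        exact (sol_W (sol_gR ν) (sol_gR (ν + b)) hy.1).continuousAt.continuousWithinAt
      · intro y hy
        exact (sol_W (sol_gR ν) (sol_gR (ν + b)) (interior_subset hy).1).hasDerivWithinAt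
      · intro y hy
        have h := interior_subset hy
        have h1 := hsub h
        exact div_pos (mul_pos (by linarith) (mul_pos h1.1.1 h1.1.2)) h.1
    have m1 : ε / 2 ∈ Ioo 0 ε := ⟨by positivity, by linarith⟩
    have m2 : ε / 4 ∈ Ioo 0 ε := ⟨by positivity, by linarith⟩
    have h1 : 0 ≤ gR ν (ε / 4) * dR (ν + b) (ε / 4) - dR ν (ε / 4) * gR (ν + b) (ε / 4) := by
      refine le_of_tendsto hl ?_
      filter_upwards [Ioo_mem_nhdsGT m2.1] with z hz
      exact (hmono ⟨hz.1, hz.2.trans m2.2⟩ m2 hz.2).le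
    have h2 := hmono m2 m1 (by linarith)
    refine W_prop hm (sol_gR ν) (sol_gR (ν + b)) (fun y hy => (S y hy).1) (fun y hy => (S y hy).2)
      (fun y hy => (zeros_unbdd hν hy).1) m1.1 (hsub m1).2.2.le (h1.trans_lt h2)
  exact final_deriv (sol_gR ν) (sol_gR (ν + b)) (fun x hx _ => hWp x hx) (fun x hx _ => hWp x hx)
    (fun x hx h0 => zero_dR hν hx h0) (fun x hx h0 => zero_dR hμ hx h0)

lemma gR_pos_of_gI_neg {ν : ℝ} (hν : 0 ≤ ν) {x : ℝ} (hx : 0 < x)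
    (h : ∀ y ∈ Ioc 0 x, gI ν y ≠ 0) : 0 < gR ν x := by
  obtain ⟨t, v, ht, ht0, hv⟩ := exists_phase hν
  have hmono : StrictMonoOn t (Ioi 0) := by
    refine strictMonoOn_of_hasDerivWithinAt_pos (convex_Ioi 0) (f' := pw ν) ?_ ?_ ?_
    · intro y hy; exact (ht y hy).continuousAt.continuousWithinAt
    · intro y hy; exact (ht y (interior_subset hy)).hasDerivWithinAt
    · intro y hy; exact pw_pos ν (interior_subset hy)
  have h1 := mono_ge_lim hmono.monotoneOn ht0 (show 0 < x / 2 by positivity)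
  have h2 : t (x / 2) < t x := hmono (show 0 < x / 2 by positivity) hx (by linarith)
  have h3 : t x < π / 2 := by
    by_contra hcon
    push Not at hcon
    obtain ⟨y, hy1, hy2⟩ := ((ht0.eventually (eventually_lt_nhds pi_div_two_pos)).and
      (Ioo_mem_nhdsGT hx)).exists
    obtain ⟨z, hz, hz0⟩ := intermediate_value_Icc (f := t) hy2.2.le (fun z hz =>
      (ht z (by linarith [hz.1, hy2.1])).continuousAt.continuousWithinAt) ⟨hy1.le, hcon⟩
    have hzp : 0 < z := by linarith [hz.1, hy2.1]
    apply h z ⟨hzp, hz.2⟩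
    rw [(hv z hzp).2.2.2, hz0, cos_pi_div_two]; simp
  rw [(hv x hx).2.2.1]
  exact mul_pos (hv x hx).1 (sin_pos_of_pos_of_lt_pi (by linarith) (by linarith [pi_pos]))

lemma zero_before {ν : ℝ} (hν : 0 ≤ ν) {x : ℝ} (hx : 0 < x) (h0 : dI ν x = 0) :
    ∃ p, 0 < p ∧ p ≤ x ∧ gI ν p = 0 := by
  by_contra hcon
  push Not at hcon
  have h1 := gR_pos_of_gI_neg hν hx (fun y hy => hcon y hy.1 hy.2)
  have hneg : gI ν x < 0 := by
    by_contra hge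
    push Not at hge
    obtain ⟨y, hy1, hy2⟩ := (((gI_atBot hν).eventually (eventually_lt_atBot 0)).and
      (Ioo_mem_nhdsGT hx)).exists
    obtain ⟨z, hz, hz0⟩ := intermediate_value_Icc (f := gI ν) hy2.2.le (fun z hz =>
      (hasDerivAt_gI_d ν (show 0 < z by linarith [hz.1, hy2.1])).continuousAt.continuousWithinAt)
      ⟨hy1.le, hge⟩
    exact hcon z (by linarith [hz.1, hy2.1]) hz.2 hz0
  have hw := wron_d ν hx
  have hd := dec_nonneg hν x hx
  have hp : 0 < 2 / π := by positivity
  unfold mr at hd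
  rw [h0] at hw hd
  have h3 : 0 < dR ν x := by nlinarith
  nlinarith [mul_pos h1 h3]

lemma zero_dI {ν : ℝ} (hν : 0 ≤ ν) {x : ℝ} (hx : 0 < x) (h0 : dI ν x = 0) : ν ^ 2 < x ^ 2 := by
  by_contra hcon
  have hxν : x ≤ ν := by
    by_contra h; push Not at h; apply hcon; nlinarith
  obtain ⟨p, hp, hpx, hp0⟩ := zero_before hν hx h0
  have hne : ∀ y, 0 < y → gI ν y = 0 → dI ν y = 0 → False := by
    intro y hy a1 a2
    have hw := wron_d ν hy
    have hp : 0 < 2 / π := by positivity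
    rw [a1, a2] at hw
    simp at hw
    linarith
  have hlt : p < x := lt_of_le_of_ne hpx (by rintro rfl; exact hne p hp hp0 h0)
  have hmono := sol_prod_mono (sol_gI ν)
  have hz : ∀ y ∈ Ioo p x, gI ν y * dI ν y = 0 := by
    intro y hy
    have hy0 : 0 < y := hp.trans hy.1
    have h1 := hmono ⟨hy0, by linarith [hy.2]⟩ ⟨hx, hxν⟩ hy.2.le
    have h2 := hmono ⟨hp, by linarith⟩ ⟨hy0, by linarith [hy.2]⟩ hy.1.le
    simp only [h0, mul_zero, hp0, zero_mul] at h1 h2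
    exact le_antisymm h1 h2
  have h3 := prod_const (sol_gI ν) hp.le hxν hz ((p + x) / 2) ⟨by linarith, by linarith⟩
  exact hne _ (by linarith) h3.1 h3.2

lemma part_Y {ν : ℝ} (hν : 0 ≤ ν) {b : ℝ} (hb : 0 < b) (hb1 : b ≤ 1) :
    InterlacedOn (fun x => dI ν x / x) (fun x => dI (ν + b) x / x) (Ioi 0) := by
  have hμ : 0 ≤ ν + b := by linarith
  have hm : ν ^ 2 < (ν + b) ^ 2 := by nlinarith
  have S := fun x (hx : 0 < x) => rot_signs hν (show ν < ν + b by linarith) (by linarith) 0 (-1)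
    (by norm_num) hx
  simp only [neg_mul, one_mul, zero_mul, zero_sub, neg_neg] at S
  refine final_deriv (sol_gI ν) (sol_gI (ν + b)) ?_ ?_
    (fun x hx h0 => zero_dI hν hx h0) (fun x hx h0 => zero_dI hμ hx h0)
  · intro x hx h0
    obtain ⟨p, hp, hpx, hp0⟩ := zero_before hν hx h0
    refine W_prop hm (sol_gI ν) (sol_gI (ν + b)) (fun y hy => (S y hy).1) (fun y hy => (S y hy).2)
      (fun y hy => (zeros_unbdd hν hy).2) hp hpx ?_
    have := (S p hp).1 hp0
    rw [hp0]; linarith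
  · intro x hx h0
    obtain ⟨p, hp, hpx, hp0⟩ := zero_before hμ hx h0
    refine W_prop hm (sol_gI ν) (sol_gI (ν + b)) (fun y hy => (S y hy).1) (fun y hy => (S y hy).2)
      (fun y hy => (zeros_unbdd hν hy).2) hp hpx ?_
    have := (S p hp).2 hp0
    rw [hp0]; linarith

lemma deriv_J (ν : ℝ) : ∀ x, 0 < x → deriv (besselJ ν) x = dR ν x / x := by
  intro x hx
  refine HasDerivAt.deriv ((hasDerivAt_gR_d ν hx).congr_of_eventuallyEq ?_)
  filter_upwards [eventually_gt_nhds hx] with y hy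
  rw [gR_eq_J ν hy]

lemma deriv_Y (ν : ℝ) : ∀ x, 0 < x → deriv (besselY ν) x = dI ν x / x := by
  intro x hx
  refine HasDerivAt.deriv ((hasDerivAt_gI_d ν hx).congr_of_eventuallyEq ?_)
  filter_upwards [eventually_gt_nhds hx] with y hy
  rw [gI_eq_Y ν hy]

/-- For `ν ≥ 0`: (i) if `0 < a ≤ 2` the positive zeros of `C_ν` and `C_{ν+a}` are
interlaced on `(0,∞)`; (ii) if `0 < b ≤ 1` the positive zeros of `J_ν′` and `J_{ν+b}′`
are interlaced on `(0,∞)`, and so are those of `Y_ν′` and `Y_{ν+b}′`. -/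
theorem known_interlacing_results (δ ν : ℝ) (hν : 0 ≤ ν) :
    (∀ a : ℝ, 0 < a → a ≤ 2 →
      InterlacedOn (cylinder δ ν) (cylinder δ (ν + a)) (Set.Ioi 0)) ∧
      (∀ b : ℝ, 0 < b → b ≤ 1 →
        InterlacedOn (deriv (besselJ ν)) (deriv (besselJ (ν + b))) (Set.Ioi 0) ∧
          InterlacedOn (deriv (besselY ν)) (deriv (besselY (ν + b))) (Set.Ioi 0)) := by
  refine ⟨fun a ha ha2 => part_one hν δ ha ha2, fun b hb hb1 => ⟨?_, ?_⟩⟩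
  · exact interlaced_congr (deriv_J ν) (deriv_J (ν + b)) (part_J hν hb hb1)
  · exact interlaced_congr (deriv_Y ν) (deriv_Y (ν + b)) (part_Y hν hb hb1)
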